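/- arXiv:0906.1651 — 2 statements merged into one kernel-verified Lean document; each statement's English description precedes it below -/
import Mathlib

section
/- Let β > n, let Ω ⊂ ℝⁿ be an open convex set, let V be a positive convex differentiable function on Ω with ∫_Ω V(x)^{−β} dx = 1, and let μ be the probability measure on Ω with density p(x) = V(x)^{−β}. Define d_V(x, y) = V(y) − V(x) − ⟨V′(x), y − x⟩ for x, y ∈ Ω. Let f, g be measurable functions on Ω satisfying f(x)V(x) ≤ g(y)V(y) + d_V(x, y) for all x, y ∈ Ω. If f is μ-integrable and g ≥ −1 on Ω, then 1 + (β/(β − n)) ∫ f dμ ≤ [∫ (1 + g)^{−β} dμ]^{−1/(β − n)}. -/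
open MeasureTheory Real
open scoped ENNReal Pointwise Topology
open Filter

lemma IsCompact.volume_add_volume_le {K L C : Set ℝ} (hK : IsCompact K) (hL : IsCompact L)
    (hK0 : K.Nonempty) (hL0 : L.Nonempty) (h : ∀ a ∈ K, ∀ b ∈ L, a + b ∈ C) :
    volume K + volume L ≤ volume C := by
  obtain ⟨k, hk, hkmax⟩ := hK.exists_isGreatest hK0
  obtain ⟨l, hl, hlmin⟩ := hL.exists_isLeast hL0
  have hsub : (· + l) '' K ∪ (k + ·) '' L ⊆ C := by
    rintro _ (⟨a, ha, rfl⟩ | ⟨b, hb, rfl⟩)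
    exacts [h a ha l hl, h k hk b hb]
  have hdisj : AEDisjoint volume ((· + l) '' K) ((k + ·) '' L) := by
    refine measure_mono_null (t := {k + l}) ?_ (by simp)
    rintro _ ⟨⟨a, ha, rfl⟩, b, hb, hab⟩
    have h1 := hkmax ha
    have h2 := hlmin hb
    simp only [Set.mem_singleton_iff] at hab ⊢
    linarith
  have hLm : MeasurableSet ((k + ·) '' L) := (hL.image (by fun_prop)).measurableSet
  calc volume K + volume L = volume ((· + l) '' K) + volume ((k + ·) '' L) := by
        simp [Set.image_add_right, Set.image_add_left, measure_preimage_add_right,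
          measure_preimage_add]
    _ = volume ((· + l) '' K ∪ (k + ·) '' L) := (measure_union₀ hLm.nullMeasurableSet hdisj).symm
    _ ≤ volume C := measure_mono hsub

/-- The one-dimensional Brunn–Minkowski inequality. -/
lemma MeasurableSet.volume_add_volume_le {A B C : Set ℝ} (hA : MeasurableSet A)
    (hB : MeasurableSet B) (hA0 : A.Nonempty) (hB0 : B.Nonempty)
    (h : ∀ a ∈ A, ∀ b ∈ B, a + b ∈ C) : volume A + volume B ≤ volume C := by
  obtain ⟨a, ha⟩ := hA0
  obtain ⟨b, hb⟩ := hB0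
  rw [hA.measure_eq_iSup_isCompact, hB.measure_eq_iSup_isCompact]
  simp only [iSup_and']
  refine ENNReal.biSup_add_biSup_le' ⟨∅, by simp⟩ ⟨∅, by simp⟩ fun K hK L hL ↦ ?_
  calc volume K + volume L ≤ volume (insert a K) + volume (insert b L) := by
        gcongr <;> exact Set.subset_insert _ _
    _ ≤ volume C := by
        refine (hK.2.insert a).volume_add_volume_le (hL.2.insert b) (Set.insert_nonempty _ _)
          (Set.insert_nonempty _ _) fun x hx y hy ↦ h x ?_ y ?_
        · exact Set.insert_subset ha hK.1 hx
        · exact Set.insert_subset hb hL.1 hy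

/-- If `f` and `g` are bounded by `1` and attain it, then their `min`-convolution has integral at
least the mean of their integrals. -/
lemma lintegral_mean_le_of_min_le {s t : ℝ} (hs : 0 < s) (ht : 0 < t) {f g h : ℝ → ℝ≥0∞}
    (hf : Measurable f) (hg : Measurable g) (hh : Measurable h)
    (hf1 : ∀ x, f x ≤ 1) (hg1 : ∀ x, g x ≤ 1) (hf0 : ∃ x, f x = 1) (hg0 : ∃ x, g x = 1)
    (H : ∀ x y, min (f x) (g y) ≤ h (s * x + t * y)) :
    ENNReal.ofReal s * (∫⁻ x, f x) + ENNReal.ofReal t * (∫⁻ x, g x) ≤ ∫⁻ x, h x := by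
  have layer : ∀ k : ℝ → ℝ≥0∞, Measurable k → (∀ x, k x ≤ 1) →
      ∫⁻ x, k x = ∫⁻ u in Set.Ioi (0 : ℝ), volume {x | u < (k x).toReal} := by
    intro k hk hk1
    rw [← lintegral_eq_lintegral_meas_lt volume (by filter_upwards with x; simp)
      hk.ennreal_toReal.aemeasurable]
    refine lintegral_congr fun x ↦ (ENNReal.ofReal_toReal ?_).symm
    exact ((hk1 x).trans_lt ENNReal.one_lt_top).ne
  have hmeas : ∀ k : ℝ → ℝ≥0∞, Measurable fun u : ℝ ↦ volume {x | u < (k x).toReal} := by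
    intro k
    refine Antitone.measurable fun u v huv ↦ measure_mono fun x hx ↦ ?_
    exact lt_of_le_of_lt huv hx
  have hset : ∀ k : ℝ → ℝ≥0∞, Measurable k → ∀ u : ℝ, MeasurableSet {x | u < (k x).toReal} :=
    fun k hk u ↦ measurableSet_lt measurable_const hk.ennreal_toReal
  calc _ ≤ ∫⁻ x, min (h x) 1 := ?_
    _ ≤ ∫⁻ x, h x := lintegral_mono fun x ↦ min_le_left _ _
  rw [layer f hf hf1, layer g hg hg1, layer _ (hh.min measurable_const) fun x ↦ min_le_right _ _,
    ← lintegral_const_mul _ (hmeas f), ← lintegral_const_mul _ (hmeas g),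
    ← lintegral_add_left ((hmeas f).const_mul _)]
  refine lintegral_mono fun u ↦ ?_
  have hsc : ∀ (c : ℝ) (hc : 0 < c) (A : Set ℝ),
      ENNReal.ofReal c * volume A = volume (c • A) := by
    intro c hc A
    rw [Measure.addHaar_smul]
    simp [abs_of_pos hc]
  rcases lt_or_ge u 1 with hu | hu
  · simp only [hsc s hs, hsc t ht]
    obtain ⟨x₀, hx₀⟩ := hf0
    obtain ⟨y₀, hy₀⟩ := hg0
    refine ((hset f hf u).const_smul_of_ne_zero hs.ne').volume_add_volume_le
      ((hset g hg u).const_smul_of_ne_zero ht.ne') ?_ ?_ ?_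
    · exact Set.Nonempty.smul_set ⟨x₀, by simpa [hx₀] using hu⟩
    · exact Set.Nonempty.smul_set ⟨y₀, by simpa [hy₀] using hu⟩
    · rintro _ ⟨x, hx, rfl⟩ _ ⟨y, hy, rfl⟩
      simp only [Set.mem_ofPred_eq, smul_eq_mul] at hx hy ⊢
      have hmin : u < (min (f x) (g y)).toReal := by
        rcases min_choice (f x) (g y) with h' | h' <;> rw [h'] <;> assumption
      refine hmin.trans_le (ENNReal.toReal_mono ?_ (le_min (H x y) ?_))
      · exact ((min_le_right _ _).trans_lt ENNReal.one_lt_top).ne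
      · exact (min_le_left _ _).trans (hf1 x)
  · have hempty : ∀ k : ℝ → ℝ≥0∞, (∀ x, k x ≤ 1) → {x | u < (k x).toReal} = ∅ := by
      intro k hk1
      refine Set.eq_empty_of_forall_notMem fun x hx ↦ ?_
      have := ENNReal.toReal_mono ENNReal.one_ne_top (hk1 x)
      simp only [Set.mem_ofPred_eq, ENNReal.toReal_one] at hx this
      linarith
    simp [hempty f hf1, hempty g hg1]

lemma ENNReal.le_rpow_mul_of_mean {s t a b P Q : ℝ≥0∞} {γ : ℝ} (hγ : 1 < γ)
    (hP : P ≠ 0) (hP' : P ≠ ∞) (hQ : Q ≠ 0) (hQ' : Q ≠ ∞) :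
    (s * a + t * b) ^ γ ≤
      (s * P + t * Q) ^ (γ - 1) * (s * (a ^ γ * P ^ (1 - γ)) + t * (b ^ γ * Q ^ (1 - γ))) := by
  have hγ0 : 0 < γ := by linarith
  have key := ENNReal.inner_le_weight_mul_Lp_of_nonneg Finset.univ hγ.le
    ![s * P, t * Q] ![a / P, b / Q]
  simp only [Fin.sum_univ_two, Matrix.cons_val_zero, Matrix.cons_val_one] at key
  have h1 : ∀ {r x R : ℝ≥0∞}, R ≠ 0 → R ≠ ∞ → r * R * (x / R) = r * x := by
    intro r x R h0 h1
    rw [mul_assoc, ENNReal.mul_div_cancel h0 h1]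
  have h2 : ∀ {r x R : ℝ≥0∞}, R ≠ 0 → R ≠ ∞ →
      r * R * (x / R) ^ γ = r * (x ^ γ * R ^ (1 - γ)) := by
    intro r x R h0 h1
    rw [ENNReal.div_rpow_of_nonneg _ _ hγ0.le, ENNReal.rpow_sub _ _ h0 h1, ENNReal.rpow_one,
      div_eq_mul_inv, div_eq_mul_inv]
    ring
  rw [h1 hP hP', h1 hQ hQ', h2 hP hP', h2 hQ hQ'] at key
  refine (ENNReal.rpow_le_rpow key hγ0.le).trans_eq ?_
  rw [ENNReal.mul_rpow_of_nonneg _ _ hγ0.le, ← ENNReal.rpow_mul, ← ENNReal.rpow_mul,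
    inv_mul_cancel₀ hγ0.ne', ENNReal.rpow_one, sub_mul, inv_mul_cancel₀ hγ0.ne', one_mul]

lemma ENNReal.rpow_neg_inv_le_iff {x y : ℝ≥0∞} {p : ℝ} (hp : 0 < p) :
    x ^ (-p⁻¹) ≤ y ↔ y ^ (-p) ≤ x := by
  rw [ENNReal.rpow_neg, ENNReal.rpow_neg, ENNReal.inv_le_iff_inv_le, ENNReal.le_rpow_inv_iff hp,
    ENNReal.inv_rpow]

lemma ENNReal.rpow_neg_anti {p : ℝ} (hp : 0 ≤ p) : Antitone fun x : ℝ≥0∞ ↦ x ^ (-p) := by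
  intro x y hxy
  simp only [ENNReal.rpow_neg]
  exact ENNReal.inv_le_inv.2 (ENNReal.rpow_le_rpow hxy hp)

lemma ENNReal.div_rpow_neg (x : ℝ≥0∞) {a : ℝ≥0∞} {γ : ℝ} (hγ : 0 < γ) (ha : a ≠ 0) (ha' : a ≠ ∞) :
    (x / a) ^ (-γ) = a ^ γ * x ^ (-γ) := by
  rw [ENNReal.rpow_neg, ENNReal.rpow_neg, ENNReal.div_rpow_of_nonneg _ _ hγ.le,
    ENNReal.inv_div (.inl (ENNReal.rpow_ne_top_of_nonneg hγ.le ha'))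
      (.inl ((ENNReal.rpow_pos ha.bot_lt ha').ne')), div_eq_mul_inv]

/-- The one-dimensional Borell–Brascamp–Lieb inequality for functions truncated at levels
which they reach. -/
lemma lintegral_rpow_neg_max_le {s t : ℝ} (hs : 0 < s) (ht : 0 < t)
    {γ : ℝ} (hγ : 1 < γ) {F G H : ℝ → ℝ≥0∞} (hF : Measurable F) (hG : Measurable G)
    (hH : Measurable H)
    (h : ∀ x y, H (s * x + t * y) ≤ ENNReal.ofReal s * F x + ENNReal.ofReal t * G y)
    {a b : ℝ≥0∞} (ha : a ≠ 0) (ha' : a ≠ ∞) (hb : b ≠ 0) (hb' : b ≠ ∞)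
    (haF : ∃ x, F x ≤ a) (hbG : ∃ y, G y ≤ b) :
    (∫⁻ x, H x ^ (-γ)) ^ (-(γ - 1)⁻¹) ≤
      ENNReal.ofReal s * (∫⁻ x, max (F x) a ^ (-γ)) ^ (-(γ - 1)⁻¹) +
      ENNReal.ofReal t * (∫⁻ x, max (G x) b ^ (-γ)) ^ (-(γ - 1)⁻¹) := by
  have hγ0 : 0 < γ := by linarith
  have hγ1 : 0 < γ - 1 := by linarith
  set S := ENNReal.ofReal s with hS
  set T := ENNReal.ofReal t with hT
  have hS0 : S ≠ 0 := by simpa [hS] using hs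
  have hT0 : T ≠ 0 := by simpa [hT] using ht
  have hS' : S ≠ ∞ := ENNReal.ofReal_ne_top
  have hT' : T ≠ ∞ := ENNReal.ofReal_ne_top
  set c := S * a + T * b with hc
  have hc0 : c ≠ 0 := by simp [hc, hS0, ha]
  have hc' : c ≠ ∞ := by
    simp [hc, ENNReal.mul_eq_top, hS', hT', ha', hb']
  have hcγ0 : c ^ γ ≠ 0 := (ENNReal.rpow_pos hc0.bot_lt hc').ne'
  have hcγ' : c ^ γ ≠ ∞ := ENNReal.rpow_ne_top_of_nonneg hγ0.le hc'
  set A := ∫⁻ x, max (F x) a ^ (-γ)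
  set B := ∫⁻ x, max (G x) b ^ (-γ)
  set X := ∫⁻ x, H x ^ (-γ)
  have hle1 : ∀ (x e : ℝ≥0∞), e ≠ 0 → e ≠ ∞ → (max x e / e) ^ (-γ) ≤ 1 := by
    intro x e he he'
    refine ENNReal.rpow_le_one_of_one_le_of_neg ?_ (by linarith)
    rw [ENNReal.le_div_iff_mul_le (.inl he) (.inl he'), one_mul]
    exact le_max_right _ _
  have heq1 : ∀ (x e : ℝ≥0∞), e ≠ 0 → e ≠ ∞ → x ≤ e → (max x e / e) ^ (-γ) = 1 := by
    intro x e he he' hx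
    rw [max_eq_right hx, ENNReal.div_self he he', ENNReal.one_rpow]
  have main := lintegral_mean_le_of_min_le hs ht
    (f := fun x ↦ (max (F x) a / a) ^ (-γ)) (g := fun x ↦ (max (G x) b / b) ^ (-γ))
    (h := fun x ↦ (H x / c) ^ (-γ)) (by fun_prop) (by fun_prop) (by fun_prop)
    (fun x ↦ hle1 _ _ ha ha') (fun x ↦ hle1 _ _ hb hb')
    (haF.imp fun x hx ↦ heq1 _ _ ha ha' hx) (hbG.imp fun x hx ↦ heq1 _ _ hb hb' hx) ?_
  · simp only [ENNReal.div_rpow_neg _ hγ0 ha ha', ENNReal.div_rpow_neg _ hγ0 hb hb',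
      ENNReal.div_rpow_neg _ hγ0 hc0 hc'] at main
    rw [lintegral_const_mul _ (by fun_prop), lintegral_const_mul _ (by fun_prop),
      lintegral_const_mul _ (by fun_prop)] at main
    change S * (a ^ γ * A) + T * (b ^ γ * B) ≤ c ^ γ * X at main
    have hX : A = ∞ ∨ B = ∞ → X = ∞ := by
      intro hAB
      have htop : S * (a ^ γ * A) + T * (b ^ γ * B) = ∞ := by
        rcases hAB with h' | h' <;>
          simp [h', ENNReal.mul_top, hS0, hT0, (ENNReal.rpow_pos ha.bot_lt ha').ne',
            (ENNReal.rpow_pos hb.bot_lt hb').ne']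
      rw [htop, top_le_iff, ENNReal.mul_eq_top] at main
      rcases main with h' | h'
      · exact h'.2
      · exact absurd h'.1 hcγ'
    by_cases hAt : A = ∞
    · simp [hX (.inl hAt), ENNReal.top_rpow_of_neg (neg_lt_zero.2 (inv_pos.2 hγ1))]
    by_cases hBt : B = ∞
    · simp [hX (.inr hBt), ENNReal.top_rpow_of_neg (neg_lt_zero.2 (inv_pos.2 hγ1))]
    by_cases hA0 : A = 0
    · simp [hA0, ENNReal.zero_rpow_of_neg (neg_lt_zero.2 (inv_pos.2 hγ1)), ENNReal.mul_top hS0]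
    by_cases hB0 : B = 0
    · simp [hB0, ENNReal.zero_rpow_of_neg (neg_lt_zero.2 (inv_pos.2 hγ1)), ENNReal.mul_top hT0]
    have hpow : ∀ Y : ℝ≥0∞, (Y ^ (-(γ - 1)⁻¹)) ^ (1 - γ) = Y := by
      intro Y
      rw [← ENNReal.rpow_mul, show -(γ - 1)⁻¹ * (1 - γ) = 1 by field_simp; ring, ENNReal.rpow_one]
    have hne0 : ∀ Y : ℝ≥0∞, Y ≠ 0 → Y ≠ ∞ → Y ^ (-(γ - 1)⁻¹) ≠ 0 :=
      fun Y h0 h1 ↦ (ENNReal.rpow_pos h0.bot_lt h1).ne'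
    have hnet : ∀ Y : ℝ≥0∞, Y ≠ 0 → Y ≠ ∞ → Y ^ (-(γ - 1)⁻¹) ≠ ∞ :=
      fun Y h0 h1 ↦ ENNReal.rpow_ne_top_of_ne_zero h0 h1
    have hol := ENNReal.le_rpow_mul_of_mean (s := S) (t := T) (a := a) (b := b) hγ
      (hne0 A hA0 hAt) (hnet A hA0 hAt) (hne0 B hB0 hBt) (hnet B hB0 hBt)
    rw [hpow, hpow] at hol
    rw [ENNReal.rpow_neg_inv_le_iff hγ1, ENNReal.rpow_neg, ← one_div]
    refine ENNReal.div_le_of_le_mul' ?_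
    set R := (S * A ^ (-(γ - 1)⁻¹) + T * B ^ (-(γ - 1)⁻¹)) ^ (γ - 1)
    have h3 : c ^ γ * 1 ≤ c ^ γ * (R * X) := by
      calc c ^ γ * 1 = c ^ γ := mul_one _
        _ ≤ R * (c ^ γ * X) := hol.trans (by gcongr)
        _ = c ^ γ * (R * X) := by ring
    exact (ENNReal.mul_le_mul_iff_right hcγ0 hcγ').1 h3
  · intro x y
    have h4 : H (s * x + t * y) / c ≤ max (max (F x) a / a) (max (G y) b / b) := by
      rw [ENNReal.div_le_iff_le_mul (.inl hc0) (.inl hc')]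
      calc H (s * x + t * y) ≤ S * F x + T * G y := h x y
        _ ≤ S * (max (F x) a / a * a) + T * (max (G y) b / b * b) := by
          rw [ENNReal.div_mul_cancel ha ha', ENNReal.div_mul_cancel hb hb']
          gcongr <;> exact le_max_left _ _
        _ ≤ S * (max (max (F x) a / a) (max (G y) b / b) * a) +
            T * (max (max (F x) a / a) (max (G y) b / b) * b) := by
          gcongr
          exacts [le_max_left _ _, le_max_right _ _]
        _ = _ := by rw [hc]; ring
    refine le_trans ?_ (ENNReal.rpow_neg_anti hγ0.le h4)
    rcases max_choice (max (F x) a / a) (max (G y) b / b) with h' | h' <;> simp only [h']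
    exacts [min_le_left _ _, min_le_right _ _]

lemma tendsto_lintegral_max_rpow_neg {γ p : ℝ} (hγ : 0 < γ) {F : ℝ → ℝ≥0∞}
    (hF : Measurable F) {a : ℕ → ℝ≥0∞} (ha : Antitone a) (h : Tendsto a atTop (𝓝 (⨅ x, F x))) :
    Tendsto (fun k ↦ (∫⁻ x, max (F x) (a k) ^ (-γ)) ^ p) atTop (𝓝 ((∫⁻ x, F x ^ (-γ)) ^ p)) := by
  refine (ENNReal.continuous_rpow_const.tendsto _).comp ?_
  refine lintegral_tendsto_of_tendsto_of_monotone (fun k ↦ by fun_prop) ?_ ?_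
  · filter_upwards with x i j hij
    exact ENNReal.rpow_neg_anti hγ.le (max_le_max le_rfl (ha hij))
  · filter_upwards with x
    refine (ENNReal.continuous_rpow_const.tendsto _).comp ?_
    have := (tendsto_const_nhds (x := F x)).max h
    rwa [max_eq_left (iInf_le F x)] at this

/-- The one-dimensional Borell–Brascamp–Lieb inequality for negative exponents. -/
lemma lintegral_rpow_neg_le_real {s t : ℝ} (hs : 0 < s) (ht : 0 < t)
    {γ : ℝ} (hγ : 1 < γ) {F G H : ℝ → ℝ≥0∞} (hF : Measurable F) (hG : Measurable G)
    (hH : Measurable H)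
    (h : ∀ x y, H (s * x + t * y) ≤ ENNReal.ofReal s * F x + ENNReal.ofReal t * G y) :
    (∫⁻ x, H x ^ (-γ)) ^ (-(γ - 1)⁻¹) ≤
      ENNReal.ofReal s * (∫⁻ x, F x ^ (-γ)) ^ (-(γ - 1)⁻¹) +
      ENNReal.ofReal t * (∫⁻ x, G x ^ (-γ)) ^ (-(γ - 1)⁻¹) := by
  have hγ0 : 0 < γ := by linarith
  have hneg : -(γ - 1)⁻¹ < 0 := neg_lt_zero.2 (inv_pos.2 (by linarith))
  have htop : ∀ F : ℝ → ℝ≥0∞, ⨅ x, F x = ∞ → (∫⁻ x, F x ^ (-γ)) ^ (-(γ - 1)⁻¹) = ∞ := by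
    intro F hF
    rw [iInf_eq_top] at hF
    simp [hF, ENNReal.top_rpow_of_neg (neg_lt_zero.2 hγ0), ENNReal.zero_rpow_of_neg hneg]
  by_cases hFi : ⨅ x, F x = ∞
  · simp [htop F hFi, ENNReal.mul_top, hs]
  by_cases hGi : ⨅ x, G x = ∞
  · simp [htop G hGi, ENNReal.mul_top, ht]
  obtain ⟨a, ha, haI, hat⟩ := exists_seq_strictAnti_tendsto' (lt_top_iff_ne_top.2 hFi)
  obtain ⟨b, hb, hbI, hbt⟩ := exists_seq_strictAnti_tendsto' (lt_top_iff_ne_top.2 hGi)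
  refine ge_of_tendsto' (x := atTop) ((ENNReal.Tendsto.const_mul
    (tendsto_lintegral_max_rpow_neg hγ0 hF ha.antitone hat) (.inr ENNReal.ofReal_ne_top)).add
    (ENNReal.Tendsto.const_mul
    (tendsto_lintegral_max_rpow_neg hγ0 hG hb.antitone hbt) (.inr ENNReal.ofReal_ne_top)))
    fun k ↦ ?_
  refine lintegral_rpow_neg_max_le hs ht hγ hF hG hH h (pos_of_gt (haI k).1).ne' (haI k).2.ne
    (pos_of_gt (hbI k).1).ne' (hbI k).2.ne ?_ ?_
  · exact (iInf_lt_iff.1 (haI k).1).imp fun _ ↦ le_of_lt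
  · exact (iInf_lt_iff.1 (hbI k).1).imp fun _ ↦ le_of_lt

/-- The **Borell–Brascamp–Lieb inequality** for negative exponents on `Fin n → ℝ`. -/
lemma lintegral_rpow_neg_le_pi {s t : ℝ} (hs : 0 < s) (ht : 0 < t) (n : ℕ)
    {γ : ℝ} (hγ : n < γ) {F G H : (Fin n → ℝ) → ℝ≥0∞} (hF : Measurable F) (hG : Measurable G)
    (hH : Measurable H)
    (h : ∀ x y, H (s • x + t • y) ≤ ENNReal.ofReal s * F x + ENNReal.ofReal t * G y) :
    (∫⁻ x, H x ^ (-γ)) ^ (-(γ - n)⁻¹) ≤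
      ENNReal.ofReal s * (∫⁻ x, F x ^ (-γ)) ^ (-(γ - n)⁻¹) +
      ENNReal.ofReal t * (∫⁻ x, G x ^ (-γ)) ^ (-(γ - n)⁻¹) := by
  induction n with
  | zero =>
    have hγ0 : 0 < γ := by simpa using hγ
    have hdirac : ∀ K : (Fin 0 → ℝ) → ℝ≥0∞, (∫⁻ x, K x ^ (-γ)) ^ (-(γ - (0 : ℕ))⁻¹) = K 0 := by
      intro K
      rw [lintegral_unique, volume_pi, Measure.pi_univ]
      simp only [Finset.univ_eq_empty, Finset.prod_empty, mul_one, Nat.cast_zero, sub_zero]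
      rw [← ENNReal.rpow_mul, neg_mul_neg, mul_inv_cancel₀ hγ0.ne', ENNReal.rpow_one]
      congr 1
      exact Subsingleton.elim _ _
    simpa only [hdirac, smul_zero, add_zero] using h 0 0
  | succ n ih =>
    push_cast at hγ ⊢
    have hn : (n : ℝ) < γ := by linarith
    have hcons : Measurable fun p : ℝ × (Fin n → ℝ) ↦ (Fin.cons p.1 p.2 : Fin (n + 1) → ℝ) := by
      refine measurable_pi_iff.2 fun i ↦ ?_
      refine Fin.cases ?_ (fun j ↦ ?_) i <;> simp only [Fin.cons_zero, Fin.cons_succ] <;> fun_prop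
    have hsplit : ∀ K : (Fin (n + 1) → ℝ) → ℝ≥0∞, Measurable K →
        ∫⁻ x, K x ^ (-γ) = ∫⁻ a : ℝ, ((∫⁻ x : Fin n → ℝ, K (Fin.cons a x) ^ (-γ)) ^
          (-(γ - n)⁻¹)) ^ (-(γ - n)) := by
      intro K hK
      have hm := (volume_preserving_piFinSuccAbove (fun _ : Fin (n + 1) ↦ ℝ) 0).symm
      rw [← hm.lintegral_comp (by fun_prop), Measure.volume_eq_prod, lintegral_prod _ (by fun_prop)]
      refine lintegral_congr fun a ↦ ?_
      rw [← ENNReal.rpow_mul, neg_mul_neg, inv_mul_cancel₀ (by linarith), ENNReal.rpow_one]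
      refine lintegral_congr fun x ↦ ?_
      simp [MeasurableEquiv.piFinSuccAbove, Fin.consEquiv]
    have hmeas : ∀ K : (Fin (n + 1) → ℝ) → ℝ≥0∞, Measurable K →
        Measurable fun a : ℝ ↦ (∫⁻ x : Fin n → ℝ, K (Fin.cons a x) ^ (-γ)) ^ (-(γ - n)⁻¹) := by
      intro K hK
      refine Measurable.pow_const ?_ _
      exact ((hK.comp hcons).pow_const _).lintegral_prod_right'
    have hsub : ∀ K : (Fin (n + 1) → ℝ) → ℝ≥0∞, Measurable K → ∀ a : ℝ,
        Measurable fun x : Fin n → ℝ ↦ K (Fin.cons a x) := by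
      intro K hK a
      exact hK.comp (hcons.comp (measurable_const.prodMk measurable_id))
    rw [hsplit F hF, hsplit G hG, hsplit H hH, ← sub_sub]
    refine lintegral_rpow_neg_le_real hs ht (by linarith) (hmeas F hF) (hmeas G hG) (hmeas H hH)
      fun a b ↦ ih hn (hsub F hF a) (hsub G hG b) (hsub H hH _) fun x y ↦ ?_
    convert h (Fin.cons a x) (Fin.cons b y) using 2
    ext i
    refine Fin.cases ?_ (fun j ↦ ?_) i <;> simp

/-- The **Borell–Brascamp–Lieb inequality** for negative exponents on Euclidean space. -/
lemma lintegral_rpow_neg_le_euclideanSpace {s t : ℝ} (hs : 0 < s) (ht : 0 < t) {n : ℕ}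
    {γ : ℝ} (hγ : n < γ) {F G H : EuclideanSpace ℝ (Fin n) → ℝ≥0∞} (hF : Measurable F)
    (hG : Measurable G) (hH : Measurable H)
    (h : ∀ x y, H (s • x + t • y) ≤ ENNReal.ofReal s * F x + ENNReal.ofReal t * G y) :
    (∫⁻ x, H x ^ (-γ)) ^ (-(γ - n)⁻¹) ≤
      ENNReal.ofReal s * (∫⁻ x, F x ^ (-γ)) ^ (-(γ - n)⁻¹) +
      ENNReal.ofReal t * (∫⁻ x, G x ^ (-γ)) ^ (-(γ - n)⁻¹) := by
  have hm := PiLp.volume_preserving_toLp (Fin n)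
  have hmm := hm.measurable
  rw [← hm.lintegral_comp (by fun_prop), ← hm.lintegral_comp (by fun_prop),
    ← hm.lintegral_comp (by fun_prop)]
  exact lintegral_rpow_neg_le_pi hs ht n hγ (hF.comp hmm) (hG.comp hmm) (hH.comp hmm)
    fun x y ↦ h (WithLp.toLp 2 x) (WithLp.toLp 2 y)

/-- A convex function lies above its tangent hyperplanes. -/
lemma ConvexOn.fderiv_sub_le {E : Type*} [NormedAddCommGroup E] [NormedSpace ℝ E] {s : Set E}
    {V : E → ℝ} (hV : ConvexOn ℝ s V) {z x : E} (hz : z ∈ s) (hx : x ∈ s)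
    (hd : DifferentiableAt ℝ V z) : V z + fderiv ℝ V z (x - z) ≤ V x := by
  have hconv := hV.comp_affineMap (AffineMap.lineMap z x : ℝ →ᵃ[ℝ] E)
  have hderiv : HasDerivAt (V ∘ (AffineMap.lineMap z x : ℝ →ᵃ[ℝ] E)) (fderiv ℝ V z (x - z)) 0 := by
    refine HasFDerivAt.comp_hasDerivAt (0 : ℝ) ?_ AffineMap.hasDerivAt_lineMap
    simpa using hd.hasFDerivAt
  have := hconv.le_slope_of_hasDerivAt (x := 0) (y := 1) (by simpa) (by simpa) one_pos hderiv
  simp only [slope_def_field, Function.comp_apply, AffineMap.lineMap_apply_one,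
    AffineMap.lineMap_apply_zero, sub_zero, div_one] at this
  linarith

lemma Real.one_sub_mul_le_rpow_neg {x p : ℝ} (hx : 0 < x) (hp : 0 ≤ p) :
    1 - p * (x - 1) ≤ x ^ (-p) := by
  rw [Real.rpow_def_of_pos hx]
  have h1 := Real.log_le_sub_one_of_pos hx
  have h2 := Real.add_one_le_exp (Real.log x * -p)
  nlinarith

lemma Real.abs_rpow_neg_sub_rpow_neg_le {ε β x y : ℝ} (hε : 0 < ε) (hβ : 0 ≤ β) (hx : ε ≤ x)
    (hy : ε ≤ y) : |x ^ (-β) - y ^ (-β)| ≤ β * ε ^ (-β - 1) * |x - y| := by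
  refine (convex_Ici ε).norm_image_sub_le_of_norm_hasDerivWithin_le
    (f := fun x : ℝ ↦ x ^ (-β)) (f' := fun x ↦ -β * x ^ (-β - 1)) (fun u hu ↦ ?_) (fun u hu ↦ ?_)
    hy hx
  · exact (Real.hasDerivAt_rpow_const (.inl (hε.trans_le hu).ne')).hasDerivWithinAt
  · have hu0 : 0 < u := hε.trans_le hu
    rw [norm_mul, norm_neg, Real.norm_of_nonneg hβ, Real.norm_of_nonneg (by positivity)]
    gcongr β * ?_
    exact Real.rpow_le_rpow_of_nonpos hε hu (by linarith)

lemma hasDerivAt_integral_max_rpow_neg {α : Type*} [MeasurableSpace α] {μ : Measure α}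
    [IsProbabilityMeasure μ] {f : α → ℝ} (hf : Integrable f μ) {ε β : ℝ} (hε : 0 < ε) (hε1 : ε < 1)
    (hβ : 0 ≤ β) :
    HasDerivAt (fun t : ℝ ↦ ∫ x, max ε (1 + t * f x) ^ (-β) ∂μ) (-β * ∫ x, f x ∂μ) 0 := by
  have hmeas : ∀ t : ℝ, AEStronglyMeasurable (fun x ↦ max ε (1 + t * f x) ^ (-β)) μ := by
    intro t
    have hfm := hf.aestronglyMeasurable.aemeasurable
    have : AEMeasurable (fun x ↦ max ε (1 + t * f x) ^ (-β)) μ :=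
      (aemeasurable_const.max ((hfm.const_mul t).const_add 1)).pow_const _
    exact this.aestronglyMeasurable
  have key := hasDerivAt_integral_of_dominated_loc_of_lip (μ := μ)
    (F := fun (t : ℝ) x ↦ max ε (1 + t * f x) ^ (-β)) (F' := fun x ↦ -β * f x) (x₀ := 0)
    (bound := fun x ↦ β * ε ^ (-β - 1) * |f x|) (s := Set.univ) univ_mem (.of_forall hmeas)
    (by simp) (hf.aestronglyMeasurable.const_mul _) (.of_forall fun x ↦ ?_)
    (hf.abs.const_mul _) (.of_forall fun x ↦ ?_)
  · simpa only [integral_const_mul] using key.2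
  · refine LipschitzOnWith.of_dist_le_mul fun t _ u _ ↦ ?_
    rw [Real.dist_eq, Real.dist_eq, Real.coe_nnabs,
      abs_of_nonneg (show 0 ≤ β * ε ^ (-β - 1) * |f x| by positivity)]
    refine (Real.abs_rpow_neg_sub_rpow_neg_le hε hβ (le_max_left _ _) (le_max_left _ _)).trans ?_
    rw [mul_assoc (β * _)]
    gcongr (β * _) * ?_
    calc |max ε (1 + t * f x) - max ε (1 + u * f x)| ≤ |(1 + t * f x) - (1 + u * f x)| := by
          simpa only [max_comm ε] using abs_max_sub_max_le_abs (1 + t * f x) (1 + u * f x) ε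
      _ = |f x| * |t - u| := by rw [← abs_mul]; exact congrArg _ (by ring)
  · have h1 : HasDerivAt (fun t : ℝ ↦ 1 + t * f x) (f x) 0 := by
      simpa using ((hasDerivAt_id (0 : ℝ)).mul_const (f x)).const_add 1
    have h2 : HasDerivAt (fun t : ℝ ↦ (1 + t * f x) ^ (-β)) (-β * f x) 0 := by
      have := h1.rpow_const (p := -β) (.inl (by simp))
      simpa [mul_comm] using this
    refine h2.congr_of_eventuallyEq ?_
    have : ∀ᶠ t in 𝓝 (0 : ℝ), ε < 1 + t * f x :=
      h1.continuousAt.eventually_const_lt (by simpa using hε1)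
    filter_upwards [this] with t ht
    rw [max_eq_right ht.le]

lemma HasDerivAt.le_of_forall_add_mul_le {Q : ℝ → ℝ} {q d : ℝ} (hQ : HasDerivAt Q q 0)
    (h : ∀ t ∈ Set.Ioo (0 : ℝ) 1, Q 0 + d * t ≤ Q t) : d ≤ q := by
  have hlim := (hasDerivAt_iff_tendsto_slope.1 hQ).mono_left
    (nhdsWithin_mono 0 fun t (ht : t ∈ Set.Ioi (0 : ℝ)) ↦ ht.ne')
  refine ge_of_tendsto hlim ?_
  filter_upwards [Ioo_mem_nhdsGT (zero_lt_one' ℝ)] with t ht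
  rw [slope_def_field, sub_zero, le_div_iff₀ ht.1]
  linarith [h t ht]

section ConvexMeasure

variable {n : ℕ} {β : ℝ} {Ω : Set (EuclideanSpace ℝ (Fin n))} {V : EuclideanSpace ℝ (Fin n) → ℝ}

lemma isProbabilityMeasure_withDensity_rpow_neg (hΩ : MeasurableSet Ω)
    (hVpos : ∀ x ∈ Ω, 0 < V x) (hnorm : ∫ x in Ω, V x ^ (-β) = 1) :
    IsProbabilityMeasure
      ((volume.restrict Ω).withDensity fun x ↦ ENNReal.ofReal (V x ^ (-β))) := by
  have hint : IntegrableOn (fun x ↦ V x ^ (-β)) Ω := by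
    by_contra hcon
    rw [integral_undef hcon] at hnorm
    exact zero_ne_one hnorm
  refine ⟨?_⟩
  rw [withDensity_apply _ .univ, Measure.restrict_univ,
    ← ofReal_integral_eq_lintegral_ofReal hint, hnorm, ENNReal.ofReal_one]
  filter_upwards [ae_restrict_mem hΩ] with x hx
  exact Real.rpow_nonneg (hVpos x hx).le _

lemma lintegral_piecewise_rpow_neg (hβ : 0 < β) (hΩ : MeasurableSet Ω) [DecidablePred (· ∈ Ω)]
    (hVpos : ∀ x ∈ Ω, 0 < V x) (hVmeas : Measurable V) {a : EuclideanSpace ℝ (Fin n) → ℝ}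
    (ha : Measurable a) (hapos : ∀ x ∈ Ω, 0 < a x) :
    ∫⁻ x, Ω.piecewise (fun x ↦ ENNReal.ofReal (V x * a x)) (fun _ ↦ ∞) x ^ (-β) =
      ∫⁻ x, ENNReal.ofReal (a x ^ (-β))
        ∂((volume.restrict Ω).withDensity fun x ↦ ENNReal.ofReal (V x ^ (-β))) := by
  rw [lintegral_withDensity_eq_lintegral_mul _ (by fun_prop) (by fun_prop),
    ← lintegral_indicator hΩ]
  refine lintegral_congr fun x ↦ ?_
  by_cases hx : x ∈ Ω
  · have h1 := hVpos x hx
    have h2 := hapos x hx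
    simp only [Set.piecewise_eq_of_mem _ _ _ hx, Set.indicator_of_mem hx, Pi.mul_apply]
    rw [ENNReal.ofReal_rpow_of_pos (mul_pos h1 h2), Real.mul_rpow h1.le h2.le,
      ENNReal.ofReal_mul (by positivity)]
  · simp [hx, ENNReal.top_rpow_of_neg, hβ]

lemma ConvexOn.mul_max_le_mean (hVconv : ConvexOn ℝ Ω V) (hVpos : ∀ x ∈ Ω, 0 < V x)
    (hVdiff : ∀ x ∈ Ω, DifferentiableAt ℝ V x) {f g : EuclideanSpace ℝ (Fin n) → ℝ} {ε : ℝ}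
    (hε : 0 < ε) (hε1 : ε < 1) (hg : ∀ y ∈ Ω, ε ≤ 1 + g y)
    (hfg : ∀ x ∈ Ω, ∀ y ∈ Ω,
      f x * V x ≤ g y * V y + (V y - V x - (fderiv ℝ V x) (y - x)))
    {t : ℝ} (ht : t ∈ Set.Ioo (0 : ℝ) 1) {x y : EuclideanSpace ℝ (Fin n)} (hx : x ∈ Ω)
    (hy : y ∈ Ω) :
    V ((1 - t) • x + t • y) * max ε (1 + t * f ((1 - t) • x + t • y)) ≤
      (1 - t) * V x + t * (V y * (1 + g y)) := by
  have ht0 : 0 < t := ht.1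
  have ht1 : 0 < 1 - t := sub_pos.2 ht.2
  have hz : (1 - t) • x + t • y ∈ Ω := hVconv.1 hx hy ht1.le ht0.le (by ring)
  have hVz := hVconv.2 hx hy ht1.le ht0.le (by ring)
  simp only [smul_eq_mul] at hVz
  set z := (1 - t) • x + t • y with hzdef
  rw [mul_max_of_nonneg _ _ (hVpos z hz).le]
  refine max_le ?_ ?_
  · have h1 : ε * V x ≤ V x := by nlinarith [hVpos x hx]
    have h2 : ε * V y ≤ V y * (1 + g y) := by nlinarith [hVpos y hy, hg y hy]
    nlinarith
  · have h1 := hVconv.fderiv_sub_le hz hx (hVdiff z hz)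
    have h2 := hfg z hz y hy
    have h3 : (1 - t) * fderiv ℝ V z (x - z) + t * fderiv ℝ V z (y - z) = 0 := by
      rw [← smul_eq_mul, ← smul_eq_mul, ← map_smul, ← map_smul, ← map_add]
      have : (1 - t) • (x - z) + t • (y - z) = 0 := by rw [hzdef]; module
      rw [this, map_zero]
    nlinarith [mul_le_mul_of_nonneg_left h1 ht1.le, mul_le_mul_of_nonneg_left h2 ht0.le]

/-- The infimum-convolution inequality when `1 + g` is bounded away from zero. -/
lemma ofReal_one_add_integral_le_of_le_one_add (hβ : (n : ℝ) < β) (hΩ : MeasurableSet Ω)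
    (hVconv : ConvexOn ℝ Ω V) (hVpos : ∀ x ∈ Ω, 0 < V x)
    (hVdiff : ∀ x ∈ Ω, DifferentiableAt ℝ V x) (hVmeas : Measurable V)
    {μ : Measure (EuclideanSpace ℝ (Fin n))} [IsProbabilityMeasure μ]
    (hμ : μ = (volume.restrict Ω).withDensity fun x ↦ ENNReal.ofReal (V x ^ (-β)))
    {f g : EuclideanSpace ℝ (Fin n) → ℝ} (hf : Measurable f) (hg : Measurable g) {ε : ℝ}
    (hε : 0 < ε) (hε1 : ε < 1) (hgε : ∀ y ∈ Ω, ε ≤ 1 + g y)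
    (hfg : ∀ x ∈ Ω, ∀ y ∈ Ω,
      f x * V x ≤ g y * V y + (V y - V x - (fderiv ℝ V x) (y - x)))
    (hfint : Integrable f μ) :
    ENNReal.ofReal (1 + β / (β - n) * ∫ x, f x ∂μ) ≤
      (∫⁻ y, ENNReal.ofReal ((1 + g y) ^ (-β)) ∂μ) ^ (-(β - n)⁻¹) := by
  classical
  have hp : 0 < β - n := sub_pos.2 hβ
  have hβ0 : 0 < β := n.cast_nonneg.trans_lt hβ
  set K := (∫⁻ y, ENNReal.ofReal ((1 + g y) ^ (-β)) ∂μ) ^ (-(β - n)⁻¹) with hK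
  by_cases hKtop : K = ∞
  · simp [hKtop]
  obtain ⟨k, hk0, hk⟩ : ∃ k : ℝ, 0 ≤ k ∧ K = ENNReal.ofReal k :=
    ⟨K.toReal, ENNReal.toReal_nonneg, (ENNReal.ofReal_toReal hKtop).symm⟩
  rw [hk]
  refine ENNReal.ofReal_le_ofReal ?_
  have hQ := hasDerivAt_integral_max_rpow_neg hfint hε hε1 hβ0.le
  suffices hd : -((β - n) * (k - 1)) ≤ -β * ∫ x, f x ∂μ by
    have : β / (β - n) * ∫ x, f x ∂μ ≤ k - 1 := by
      rw [div_mul_eq_mul_div, div_le_iff₀ hp]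
      linarith
    linarith
  refine hQ.le_of_forall_add_mul_le fun t ht ↦ ?_
  have ht0 : 0 < t := ht.1
  have ht1 : 0 < 1 - t := sub_pos.2 ht.2
  have hr : 0 < 1 - t + t * k := by nlinarith [mul_nonneg ht0.le hk0]
  have hmax : ∀ x, 0 < max ε (1 + t * f x) := fun x ↦ lt_max_of_lt_left hε
  have hbbl := lintegral_rpow_neg_le_euclideanSpace ht1 ht0 hβ
    (F := Ω.piecewise (fun x ↦ ENNReal.ofReal (V x * 1)) (fun _ ↦ ∞))
    (G := Ω.piecewise (fun x ↦ ENNReal.ofReal (V x * (1 + g x))) (fun _ ↦ ∞))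
    (H := Ω.piecewise (fun x ↦ ENNReal.ofReal (V x * max ε (1 + t * f x))) (fun _ ↦ ∞))
    (Measurable.piecewise hΩ (by fun_prop) (by fun_prop))
    (Measurable.piecewise hΩ (by fun_prop) (by fun_prop))
    (Measurable.piecewise hΩ (by fun_prop) (by fun_prop)) fun x y ↦ ?_
  · rw [lintegral_piecewise_rpow_neg hβ0 hΩ hVpos hVmeas measurable_const (by simp),
      lintegral_piecewise_rpow_neg hβ0 hΩ hVpos hVmeas (a := fun x ↦ 1 + g x) (by fun_prop)
        fun x hx ↦ hε.trans_le (hgε x hx),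
      lintegral_piecewise_rpow_neg hβ0 hΩ hVpos hVmeas (a := fun x ↦ max ε (1 + t * f x))
        (by fun_prop) fun x _ ↦ hmax x, ← hμ, ← hK, hk, ENNReal.rpow_neg_inv_le_iff hp] at hbbl
    simp only [Real.one_rpow, ENNReal.ofReal_one, lintegral_const, measure_univ, mul_one,
      ENNReal.one_rpow] at hbbl
    rw [← ENNReal.ofReal_mul ht0.le, ← ENNReal.ofReal_add ht1.le (by positivity),
      ENNReal.ofReal_rpow_of_pos hr, ← ofReal_integral_eq_lintegral_ofReal,
      ENNReal.ofReal_le_ofReal_iff (integral_nonneg fun x ↦ Real.rpow_nonneg (hmax x).le _)] at hbbl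
    · have := Real.one_sub_mul_le_rpow_neg hr hp.le
      have h0 : ∫ x, max ε (1 + 0 * f x) ^ (-β) ∂μ = 1 := by simp [max_eq_right hε1.le]
      rw [h0]
      linarith
    · refine Integrable.of_bound (C := ε ^ (-β))
        (Measurable.aestronglyMeasurable (by fun_prop)) (.of_forall fun x ↦ ?_)
      rw [Real.norm_of_nonneg (Real.rpow_nonneg (hmax x).le _)]
      exact Real.rpow_le_rpow_of_nonpos hε (le_max_left _ _) (by linarith)
    · exact .of_forall fun x ↦ Real.rpow_nonneg (hmax x).le _
  · by_cases hx : x ∈ Ω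
    · by_cases hy : y ∈ Ω
      · have hz : (1 - t) • x + t • y ∈ Ω := hVconv.1 hx hy ht1.le ht0.le (by ring)
        have h1 := hVpos x hx
        have h2 := hVpos y hy
        have h3 := hε.trans_le (hgε y hy)
        simp only [Set.piecewise_eq_of_mem _ _ _ hx, Set.piecewise_eq_of_mem _ _ _ hy,
          Set.piecewise_eq_of_mem _ _ _ hz]
        rw [← ENNReal.ofReal_mul ht1.le, ← ENNReal.ofReal_mul ht0.le,
          ← ENNReal.ofReal_add (by positivity) (by positivity), mul_one]
        exact ENNReal.ofReal_le_ofReal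
          (hVconv.mul_max_le_mean hVpos hVdiff hε hε1 hgε hfg ht hx hy)
      · simp [hy, ENNReal.mul_top, ht0]
    · simp [hx, ENNReal.mul_top, ht.2]

end ConvexMeasure



/-- **Theorem 2.1 (Bobkov–Ledoux)**: let `μ` be the probability measure on an open
convex set `Ω ⊆ ℝⁿ` with density `V^{−β}`, `β > n`, where `V` is positive, convex and
differentiable on `Ω`, with `∫_Ω V^{−β} dx = 1`.  If measurable functions `f, g` on `Ω`
satisfy `f(x)V(x) ≤ g(y)V(y) + d_V(x,y)` for all `x, y ∈ Ω`, where
`d_V(x,y) = V(y) − V(x) − ⟨V′(x), y − x⟩`, `f` is `μ`-integrable and `g ≥ −1` on `Ω`,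
then `1 + (β/(β−n)) ∫ f dμ ≤ [∫ (1+g)^{−β} dμ]^{−1/(β−n)}`. -/
theorem infConv_ineq_convex_measure
    {n : ℕ} (hn : 0 < n) (β : ℝ) (hβ : (n : ℝ) < β)
    (Ω : Set (EuclideanSpace ℝ (Fin n))) (hΩo : IsOpen Ω) (hΩc : Convex ℝ Ω)
    (V : EuclideanSpace ℝ (Fin n) → ℝ)
    (hVpos : ∀ x ∈ Ω, 0 < V x) (hVconv : ConvexOn ℝ Ω V)
    (hVdiff : ∀ x ∈ Ω, DifferentiableAt ℝ V x) (hVmeas : Measurable V)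
    (hnorm : ∫ x in Ω, V x ^ (-β) = 1)
    (μ : Measure (EuclideanSpace ℝ (Fin n)))
    (hμ : μ = (volume.restrict Ω).withDensity fun x => ENNReal.ofReal (V x ^ (-β)))
    (f g : EuclideanSpace ℝ (Fin n) → ℝ) (hf : Measurable f) (hg : Measurable g)
    (hg1 : ∀ y ∈ Ω, -1 ≤ g y)
    (hfg : ∀ x ∈ Ω, ∀ y ∈ Ω,
      f x * V x ≤ g y * V y + (V y - V x - (fderiv ℝ V x) (y - x)))
    (hfint : Integrable f μ) :
    ENNReal.ofReal (1 + (β / (β - n)) * ∫ x, f x ∂μ) ≤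
      (∫⁻ y, ENNReal.ofReal ((1 + g y) ^ (-β)) ∂μ) ^ (-(1 / (β - n))) := by
  have hΩ := hΩo.measurableSet
  have hp : 0 < β - n := sub_pos.2 hβ
  have hprob : IsProbabilityMeasure μ :=
    hμ ▸ isProbabilityMeasure_withDensity_rpow_neg hΩ hVpos hnorm
  have hae : ∀ᵐ y ∂μ, y ∈ Ω := by
    rw [hμ]
    exact (withDensity_absolutelyContinuous _ _).ae_le (ae_restrict_mem hΩ)
  set L := ENNReal.ofReal (1 + (β / (β - n)) * ∫ x, f x ∂μ) with hL
  have hdual : ∀ J : ℝ≥0∞, L ≤ J ^ (-(β - n)⁻¹) ↔ J ≤ L ^ (-(β - n)) := by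
    intro J
    rw [ENNReal.rpow_neg, ENNReal.rpow_neg, ENNReal.le_inv_iff_le_inv,
      ENNReal.rpow_inv_le_iff hp, ENNReal.inv_rpow]
  obtain ⟨ε, -, hε, hεlim⟩ := exists_seq_strictAnti_tendsto' (zero_lt_one' ℝ)
  rw [one_div, hdual]
  have htrunc : ∀ k, ∫⁻ y, ENNReal.ofReal ((1 + max (g y) (ε k - 1)) ^ (-β)) ∂μ ≤
      L ^ (-(β - n)) := by
    intro k
    rw [← hdual]
    refine ofReal_one_add_integral_le_of_le_one_add hβ hΩ hVconv hVpos hVdiff hVmeas hμ hf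
      (hg.max measurable_const) (hε k).1 (hε k).2 (fun y _ ↦ ?_) (fun x hx y hy ↦ ?_) hfint
    · linarith [le_max_right (g y) (ε k - 1)]
    · refine (hfg x hx y hy).trans ?_
      have := (hVpos y hy).le
      gcongr
      exact le_max_left _ _
  calc ∫⁻ y, ENNReal.ofReal ((1 + g y) ^ (-β)) ∂μ
      ≤ ∫⁻ y, liminf (fun k ↦ ENNReal.ofReal ((1 + max (g y) (ε k - 1)) ^ (-β))) atTop ∂μ := by
        refine lintegral_mono_ae ?_
        filter_upwards [hae] with y hy
        rcases (hg1 y hy).eq_or_lt with h0 | h0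
        · have hβ0 : -β ≠ 0 := by linarith [n.cast_nonneg (α := ℝ)]
          simp [← h0, Real.zero_rpow hβ0]
        · refine le_of_eq (Tendsto.liminf_eq (tendsto_const_nhds.congr' ?_)).symm
          filter_upwards [hεlim.eventually_lt_const (show 0 < 1 + g y by linarith)] with k hk
          rw [max_eq_left (by linarith)]
    _ ≤ liminf (fun k ↦ ∫⁻ y, ENNReal.ofReal ((1 + max (g y) (ε k - 1)) ^ (-β)) ∂μ) atTop :=
        lintegral_liminf_le fun k ↦ by fun_prop
    _ ≤ L ^ (-(β - n)) := by
        refine liminf_le_of_le ?_ fun b hb ↦ ?_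
        · isBoundedDefault
        · obtain ⟨k, hk⟩ := hb.exists
          exact hk.trans (htrunc k)
end

section
/- Let β ≥ n + 1 and let 𝜈̃_β be the image of the generalized Cauchy distribution ν_β under the map x ↦ √(2β − n)·x, i.e. the probability measure on ℝⁿ with density proportional to (1 + |x|²/(2β − n))^{−β}. Set p = 2⌊β − 3n/4⌋, t₀ = 4√(e⌊β − 3n/4⌋), t₁ = 7e⌊β − 3n/4⌋. Then for any function f on ℝⁿ with ‖f‖_Lip ≤ 1 and ∫ f d𝜈̃_β = 0: 𝜈̃_β(|f| ≥ t) ≤ 2 e^{−t²/(32e)} if 0 ≤ t < t₀; 𝜈̃_β(|f| ≥ t) ≤ 2 e^{−t/(7e)} if t₀ ≤ t ≤ t₁; and 𝜈̃_β(|f| ≥ t) ≤ 2 (7p/t)^p if t ≥ t₁. -/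
open MeasureTheory Real
open scoped ENNReal

/-- The rescaled generalized Cauchy distribution `ν̃_β` on `ℝⁿ`, i.e. the image of `ν_β`
under `x ↦ √(2β−n)·x`: the probability measure with density proportional to
`(1 + |x|²/(2β−n))^{−β}`. -/
noncomputable def tildeCauchyMeasure (n : ℕ) (β : ℝ) : Measure (EuclideanSpace ℝ (Fin n)) :=
  volume.withDensity fun x =>
    ENNReal.ofReal
      ((1 + ‖x‖ ^ 2 / (2 * β - n)) ^ (-β) /
        ∫ y : EuclideanSpace ℝ (Fin n), (1 + ‖y‖ ^ 2 / (2 * β - n)) ^ (-β))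

section Auxiliary

open MeasureTheory Real ProbabilityTheory Set Filter
open scoped ENNReal NNReal Nat RealInnerProductSpace

/-- The even moments of the standard real Gaussian are double factorials. -/
lemma integral_even_pow_gaussianReal (k : ℕ) :
    ∫ x, x ^ (2 * k) ∂gaussianReal 0 1 = ((2 * k - 1 : ℕ)‼ : ℝ) := by
  rw [integral_gaussianReal_eq_integral_smul one_ne_zero]
  have h1 : ∀ x : ℝ, gaussianPDFReal 0 1 x • x ^ (2 * k) =
      (√(2 * π))⁻¹ * (fun y : ℝ => y ^ (2 * (k : ℝ)) * rexp (-(1 / 2) * y ^ (2 : ℝ))) |x| := by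
    intro x
    simp only [gaussianPDFReal, smul_eq_mul, NNReal.coe_one, mul_one, sub_zero]
    rw [show (2 * (k : ℝ)) = ((2 * k : ℕ) : ℝ) by push_cast; ring, rpow_natCast,
      show (2 : ℝ) = ((2 : ℕ) : ℝ) by norm_num, rpow_natCast]
    simp only [pow_mul, sq_abs]
    push_cast
    ring_nf
  simp_rw [h1]
  rw [integral_const_mul,
    integral_comp_abs (f := fun y : ℝ => y ^ (2 * (k : ℝ)) * rexp (-(1 / 2) * y ^ (2 : ℝ))),
    integral_rpow_mul_exp_neg_mul_rpow (by norm_num)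
    (by have : (0 : ℝ) ≤ k := k.cast_nonneg
        linarith) (by norm_num),
    show (2 * (k : ℝ) + 1) / 2 = k + 1 / 2 by ring, Real.Gamma_nat_add_half]
  rw [show -(2 * (k : ℝ) + 1) / 2 = -(k + 1 / 2) by ring, one_div, inv_rpow (by norm_num),
    ← one_div (2 : ℝ), rpow_neg (by norm_num), inv_inv, rpow_add (by norm_num), rpow_natCast,
    ← sqrt_eq_rpow, sqrt_mul (by norm_num)]
  have : √2 ≠ 0 := by positivity
  have : √π ≠ 0 := by positivity
  field_simp

lemma integrable_even_pow_gaussianReal (k : ℕ) :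
    Integrable (fun x : ℝ => x ^ (2 * k)) (gaussianReal 0 1) := by
  refine Integrable.of_integral_ne_zero ?_
  rw [integral_even_pow_gaussianReal]
  exact_mod_cast (Nat.doubleFactorial_pos _).ne'

lemma lintegral_even_pow_gaussianReal (k : ℕ) :
    ∫⁻ x, ENNReal.ofReal (x ^ (2 * k)) ∂gaussianReal 0 1 =
      ENNReal.ofReal ((2 * k - 1 : ℕ)‼ : ℝ) := by
  rw [← integral_even_pow_gaussianReal, ofReal_integral_eq_lintegral_ofReal
    (integrable_even_pow_gaussianReal k)]
  exact ae_of_all _ fun x => (even_two_mul k).pow_nonneg x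

section StdGaussian

variable {E : Type*} [NormedAddCommGroup E] [InnerProductSpace ℝ E] [FiniteDimensional ℝ E]
  [MeasurableSpace E] [BorelSpace E]

lemma map_strongDual_stdGaussian (L : StrongDual ℝ E) :
    (stdGaussian E).map L = (gaussianReal 0 1).map (fun x => ‖L‖ * x) := by
  rw [IsGaussian.map_eq_gaussianReal, variance_dual_stdGaussian, integral_strongDual_stdGaussian,
    gaussianReal_map_const_mul]
  congr 1
  · simp
  · ext
    simp

lemma lintegral_even_pow_strongDual_stdGaussian (L : StrongDual ℝ E) (k : ℕ) :
    ∫⁻ x, ENNReal.ofReal (L x ^ (2 * k)) ∂stdGaussian E =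
      ENNReal.ofReal (‖L‖ ^ (2 * k) * ((2 * k - 1 : ℕ)‼ : ℝ)) := by
  have h : ∫⁻ y, ENNReal.ofReal (y ^ (2 * k)) ∂(stdGaussian E).map L =
      ∫⁻ x, ENNReal.ofReal (L x ^ (2 * k)) ∂stdGaussian E :=
    lintegral_map (by fun_prop) (by fun_prop)
  rw [← h, map_strongDual_stdGaussian, lintegral_map (by fun_prop) (by fun_prop)]
  simp_rw [mul_pow, ENNReal.ofReal_mul ((even_two_mul k).pow_nonneg ‖L‖)]
  rw [lintegral_const_mul _ (by fun_prop), lintegral_even_pow_gaussianReal]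

end StdGaussian

lemma lintegral_norm_pow_stdGaussian_le (n m : ℕ) :
    ∫⁻ x, ENNReal.ofReal (‖x‖ ^ (2 * m)) ∂stdGaussian (EuclideanSpace ℝ (Fin n)) ≤
      ENNReal.ofReal ((n : ℝ) ^ m * ((2 * m - 1 : ℕ)‼ : ℝ)) := by
  rcases Nat.eq_zero_or_pos m with rfl | hm
  · simp
  obtain ⟨m, rfl⟩ : ∃ l, m = l + 1 := ⟨m - 1, by omega⟩
  have hpt : ∀ x : EuclideanSpace ℝ (Fin n), ENNReal.ofReal (‖x‖ ^ (2 * (m + 1))) ≤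
      ∑ i : Fin n, ENNReal.ofReal ((n : ℝ) ^ m) *
        ENNReal.ofReal ((EuclideanSpace.proj (𝕜 := ℝ) i) x ^ (2 * (m + 1))) := by
    intro x
    simp_rw [← ENNReal.ofReal_mul (show (0 : ℝ) ≤ (n : ℝ) ^ m by positivity)]
    rw [← ENNReal.ofReal_sum_of_nonneg
      (fun i _ => mul_nonneg (by positivity) ((even_two_mul _).pow_nonneg _))]
    refine ENNReal.ofReal_le_ofReal ?_
    rw [pow_mul, EuclideanSpace.real_norm_sq_eq, ← Finset.mul_sum]
    have h := pow_sum_le_card_mul_sum_pow (s := Finset.univ) (f := fun i => x i ^ 2)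
      (fun i _ => sq_nonneg _) m
    simpa [pow_mul] using h
  refine (lintegral_mono hpt).trans ?_
  rw [lintegral_finsetSum _ (fun i _ => by fun_prop)]
  calc _ ≤ ∑ i : Fin n, ENNReal.ofReal ((n : ℝ) ^ m) *
        ENNReal.ofReal ((2 * (m + 1) - 1 : ℕ)‼ : ℝ) := by
        refine Finset.sum_le_sum fun i _ => ?_
        rw [lintegral_const_mul _ (by fun_prop), lintegral_even_pow_strongDual_stdGaussian]
        gcongr
        have : ‖(EuclideanSpace.proj (𝕜 := ℝ) i : EuclideanSpace ℝ (Fin n) →L[ℝ] ℝ)‖ ≤ 1 := by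
          refine ContinuousLinearMap.opNorm_le_bound _ zero_le_one fun x => ?_
          rw [one_mul]
          exact PiLp.norm_apply_le x i
        exact mul_le_of_le_one_left (by positivity) (pow_le_one₀ (norm_nonneg _) this)
    _ = _ := by
        rw [Finset.sum_const, Finset.card_univ, Fintype.card_fin, nsmul_eq_mul,
          ← ENNReal.ofReal_mul (by positivity), ← ENNReal.ofReal_natCast,
          ← ENNReal.ofReal_mul (by positivity)]
        congr 1
        ring

/-- Jensen's inequality for even powers, with the right-hand side possibly infinite. -/
lemma ofReal_integral_even_pow_le {Ω : Type*} [MeasurableSpace Ω] {μ : Measure Ω}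
    [IsProbabilityMeasure μ] {f : Ω → ℝ} (hf : Integrable f μ) (k : ℕ) :
    ENNReal.ofReal ((∫ x, f x ∂μ) ^ (2 * k)) ≤ ∫⁻ x, ENNReal.ofReal (f x ^ (2 * k)) ∂μ := by
  have hnn : ∀ x, 0 ≤ f x ^ (2 * k) := fun x => (even_two_mul k).pow_nonneg _
  have hm : AEStronglyMeasurable (fun x => f x ^ (2 * k)) μ := hf.aestronglyMeasurable.pow _
  by_cases h : ∫⁻ x, ENNReal.ofReal (f x ^ (2 * k)) ∂μ = ∞
  · simp [h]
  have hi : Integrable (fun x => f x ^ (2 * k)) μ :=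
    (lintegral_ofReal_ne_top_iff_integrable hm (ae_of_all _ hnn)).1 h
  rw [← ofReal_integral_eq_lintegral_ofReal hi (ae_of_all _ hnn)]
  exact ENNReal.ofReal_le_ofReal <| (even_two_mul k).convexOn_pow.map_integral_le
    (by fun_prop) isClosed_univ (by simp) hf hi

lemma ofReal_intervalIntegral_even_pow_le {f : ℝ → ℝ} (hf : Continuous f) {a : ℝ} (ha : 0 < a)
    (k : ℕ) :
    ENNReal.ofReal ((∫ x in 0..a, f x) ^ (2 * k)) ≤
      ENNReal.ofReal (a ^ (2 * k)) *
        ((ENNReal.ofReal a)⁻¹ * ∫⁻ x in Ioc 0 a, ENNReal.ofReal (f x ^ (2 * k))) := by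
  have hpos : ENNReal.ofReal a ≠ 0 := by simpa using ha
  set μ : Measure ℝ := (ENNReal.ofReal a)⁻¹ • volume.restrict (Ioc 0 a) with hμ
  have : IsProbabilityMeasure μ := ⟨by
    simp [hμ, ENNReal.inv_mul_cancel hpos]⟩
  have hi : Integrable f μ := by
    refine Integrable.smul_measure ?_ (by simpa using ha)
    exact (hf.integrableOn_Icc).mono_set Ioc_subset_Icc_self
  have h := ofReal_integral_even_pow_le hi k
  rw [hμ, integral_smul_measure, lintegral_smul_measure] at h
  rw [intervalIntegral.integral_of_le ha.le]
  have e : ∫ x in Ioc 0 a, f x = a * ((ENNReal.ofReal a)⁻¹.toReal • ∫ x in Ioc 0 a, f x) := by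
    rw [ENNReal.toReal_inv, ENNReal.toReal_ofReal ha.le, smul_eq_mul, mul_inv_cancel_left₀ ha.ne']
  rw [e, mul_pow, ENNReal.ofReal_mul (by positivity)]
  gcongr
  exact h

section StdGaussian

variable {E : Type*} [NormedAddCommGroup E] [InnerProductSpace ℝ E] [FiniteDimensional ℝ E]
  [MeasurableSpace E] [BorelSpace E]

lemma lintegral_sub_even_pow_stdGaussian_le_of_contDiff {f : E → ℝ} (hf : ContDiff ℝ 1 f)
    (hL : LipschitzWith 1 f) (k : ℕ) :
    ∫⁻ z, ENNReal.ofReal ((f z.2 - f z.1) ^ (2 * k)) ∂(stdGaussian E).prod (stdGaussian E) ≤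
      ENNReal.ofReal ((π / 2) ^ (2 * k) * ((2 * k - 1 : ℕ)‼ : ℝ)) := by
  set G := stdGaussian E
  set D : ℝ → E × E → ℝ := fun θ z =>
    fderiv ℝ f (ContinuousLinearMap.rotation θ z).1 (ContinuousLinearMap.rotation θ z).2 with hD
  have hf' : Continuous (fderiv ℝ f) := hf.continuous_fderiv (by norm_num)
  have hDc : Continuous (fun p : ℝ × E × E => D p.1 p.2) := by
    simp only [hD, ContinuousLinearMap.rotation_apply]
    exact (hf'.comp (by fun_prop)).clm_apply (by fun_prop)
  have hftc : ∀ z : E × E, f z.2 - f z.1 = ∫ θ in 0..(π / 2), D θ z := by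
    intro z
    have hder : ∀ θ ∈ uIcc 0 (π / 2), HasDerivAt
        (fun θ => f (Real.cos θ • z.1 + Real.sin θ • z.2)) (D θ z) θ := by
      intro θ _
      have h1 : HasDerivAt (fun θ : ℝ => Real.cos θ • z.1 + Real.sin θ • z.2)
          ((-Real.sin θ) • z.1 + Real.cos θ • z.2) θ :=
        ((Real.hasDerivAt_cos θ).smul_const z.1).add ((Real.hasDerivAt_sin θ).smul_const z.2)
      have h2 := ((hf.differentiable (by norm_num))
        (Real.cos θ • z.1 + Real.sin θ • z.2)).hasFDerivAt.comp_hasDerivAt θ h1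
      rw [show D θ z = fderiv ℝ f (Real.cos θ • z.1 + Real.sin θ • z.2)
        (-Real.sin θ • z.1 + Real.cos θ • z.2) by simp [hD, ContinuousLinearMap.rotation_apply]]
      exact h2
    rw [intervalIntegral.integral_eq_sub_of_hasDerivAt hder
      ((hDc.comp (by fun_prop : Continuous fun θ : ℝ => (θ, z))).intervalIntegrable _ _)]
    simp
  have hinner : ∀ θ, ∫⁻ z, ENNReal.ofReal (D θ z ^ (2 * k)) ∂G.prod G ≤
      ENNReal.ofReal ((2 * k - 1 : ℕ)‼ : ℝ) := by
    intro θ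
    have hg : Measurable fun z : E × E => ENNReal.ofReal ((fderiv ℝ f z.1 z.2) ^ (2 * k)) :=
      (((hf'.comp continuous_fst).clm_apply continuous_snd).pow _).measurable.ennreal_ofReal
    have hrot : (G.prod G).map (ContinuousLinearMap.rotation θ) = G.prod G :=
      IsGaussian.map_rotation_eq_self (by simp [G]) θ
    calc _ = ∫⁻ z, ENNReal.ofReal ((fderiv ℝ f z.1 z.2) ^ (2 * k)) ∂G.prod G := by
          conv_rhs => rw [← hrot, lintegral_map hg (by fun_prop)]
      _ = ∫⁻ x, ∫⁻ y, ENNReal.ofReal ((fderiv ℝ f x y) ^ (2 * k)) ∂G ∂G :=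
          lintegral_prod _ hg.aemeasurable
      _ ≤ ∫⁻ x, ENNReal.ofReal ((2 * k - 1 : ℕ)‼ : ℝ) ∂G := by
          refine lintegral_mono fun x => ?_
          rw [lintegral_even_pow_strongDual_stdGaussian]
          refine ENNReal.ofReal_le_ofReal ?_
          refine mul_le_of_le_one_left (by positivity) (pow_le_one₀ (norm_nonneg _) ?_)
          simpa using norm_fderiv_le_of_lipschitz ℝ hL (x₀ := x)
      _ = _ := by simp
  have hpi : ENNReal.ofReal (π / 2) ≠ 0 := by simpa using pi_pos
  clear_value D
  calc _ ≤ ∫⁻ z, (ENNReal.ofReal ((π / 2) ^ (2 * k)) * ((ENNReal.ofReal (π / 2))⁻¹ *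
        ∫⁻ θ in Ioc 0 (π / 2), ENNReal.ofReal (D θ z ^ (2 * k)))) ∂G.prod G := by
        refine lintegral_mono fun z => ?_
        rw [hftc z]
        exact ofReal_intervalIntegral_even_pow_le
          (hDc.comp (by fun_prop : Continuous fun θ : ℝ => (θ, z))) (by positivity) k
    _ = ENNReal.ofReal ((π / 2) ^ (2 * k)) * ((ENNReal.ofReal (π / 2))⁻¹ *
        ∫⁻ z, (∫⁻ θ in Ioc 0 (π / 2), ENNReal.ofReal (D θ z ^ (2 * k))) ∂G.prod G) := by
        rw [lintegral_const_mul' _ _ (by simp), lintegral_const_mul' _ _ (by simpa using pi_pos)]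
    _ = ENNReal.ofReal ((π / 2) ^ (2 * k)) * ((ENNReal.ofReal (π / 2))⁻¹ *
        ∫⁻ θ in Ioc 0 (π / 2), (∫⁻ z, ENNReal.ofReal (D θ z ^ (2 * k)) ∂G.prod G)) := by
        rw [lintegral_lintegral_swap]
        have : Continuous (fun p : (E × E) × ℝ => D p.2 p.1) := hDc.comp continuous_swap
        exact (this.measurable.pow_const (2 * k)).ennreal_ofReal.aemeasurable
    _ ≤ ENNReal.ofReal ((π / 2) ^ (2 * k)) * ((ENNReal.ofReal (π / 2))⁻¹ *
        ∫⁻ θ in Ioc 0 (π / 2), ENNReal.ofReal ((2 * k - 1 : ℕ)‼ : ℝ)) := by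
        gcongr with θ
        exact hinner θ
    _ = _ := by
        rw [setLIntegral_const, Real.volume_Ioc, sub_zero, mul_comm (ENNReal.ofReal _)
          (ENNReal.ofReal (π / 2)), ENNReal.inv_mul_cancel_left hpi (by simp),
          ENNReal.ofReal_mul (by positivity)]

lemma exists_contDiff_lipschitz_approx {f : E → ℝ} (hf : LipschitzWith 1 f) {ε : ℝ}
    (hε : 0 < ε) :
    ∃ g : E → ℝ, ContDiff ℝ 1 g ∧ LipschitzWith 1 g ∧ ∀ x, |g x - f x| ≤ ε := by
  set b : ContDiffBump (0 : E) := ⟨ε / 2, ε, half_pos hε, half_lt_self hε⟩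
  set g : E → ℝ := MeasureTheory.convolution (b.normed volume) f
    (ContinuousLinearMap.lsmul ℝ ℝ) volume with hg
  have hcs := b.hasCompactSupport_normed (μ := volume)
  have hex : ConvolutionExists (b.normed volume) f (ContinuousLinearMap.lsmul ℝ ℝ) volume :=
    hcs.convolutionExists_left_of_continuous_right _
      (b.continuous_normed.locallyIntegrable) hf.continuous
  refine ⟨g, ?_, ?_, fun x => ?_⟩
  · exact hcs.contDiff_convolution_left (n := 1) _ b.contDiff_normed
      hf.continuous.locallyIntegrable
  · refine LipschitzWith.of_dist_le_mul fun x y => ?_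
    rw [dist_eq_norm, hg, convolution_def, convolution_def,
      ← integral_sub (hex x).integrable (hex y).integrable]
    calc _ ≤ ∫ t, b.normed volume t * dist x y := by
          refine norm_integral_le_of_norm_le (b.integrable_normed.mul_const _)
            (ae_of_all _ fun t => ?_)
          rw [← map_sub, ContinuousLinearMap.lsmul_apply, norm_smul, Real.norm_of_nonneg
            (b.nonneg_normed t), ← dist_eq_norm]
          refine mul_le_mul_of_nonneg_left ?_ (b.nonneg_normed t)
          simpa using hf.dist_le_mul (x - t) (y - t)
      _ = _ := by
          rw [integral_mul_const, b.integral_normed]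
          simp
  · rw [← Real.dist_eq]
    refine b.dist_normed_convolution_le hf.continuous.aestronglyMeasurable fun y hy => ?_
    refine (hf.dist_le_mul y x).trans ?_
    simpa using (Metric.mem_ball.1 hy).le

/-- Moment form of the Maurey-Pisier Gaussian concentration inequality. -/
lemma lintegral_sub_even_pow_stdGaussian_le {f : E → ℝ} (hf : LipschitzWith 1 f) (k : ℕ) :
    ∫⁻ z, ENNReal.ofReal ((f z.2 - f z.1) ^ (2 * k)) ∂(stdGaussian E).prod (stdGaussian E) ≤
      ENNReal.ofReal ((π / 2) ^ (2 * k) * ((2 * k - 1 : ℕ)‼ : ℝ)) := by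
  have h : ∀ j : ℕ, ∃ g : E → ℝ, ContDiff ℝ 1 g ∧ LipschitzWith 1 g ∧
      ∀ x, |g x - f x| ≤ 1 / ((j : ℝ) + 1) := fun j =>
    exists_contDiff_lipschitz_approx hf (by positivity)
  choose g hg1 hg2 hg3 using h
  have hlim : ∀ x, Tendsto (fun j => g j x) atTop (nhds (f x)) := fun x => by
    rw [tendsto_iff_dist_tendsto_zero]
    exact squeeze_zero (fun _ => dist_nonneg) (fun j => hg3 j x)
      tendsto_one_div_add_atTop_nhds_zero_nat
  have hlim2 : ∀ z : E × E, ENNReal.ofReal ((f z.2 - f z.1) ^ (2 * k)) =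
      liminf (fun j => ENNReal.ofReal ((g j z.2 - g j z.1) ^ (2 * k))) atTop := fun z =>
    (ENNReal.tendsto_ofReal (((hlim z.2).sub (hlim z.1)).pow _)).liminf_eq.symm
  simp_rw [hlim2]
  refine (lintegral_liminf_le fun j => ?_).trans ?_
  · have := (hg1 j).continuous
    exact (by fun_prop : Continuous fun z : E × E =>
      (g j z.2 - g j z.1) ^ (2 * k)).measurable.ennreal_ofReal
  · refine liminf_le_of_le (by isBoundedDefault) fun c hc => ?_
    obtain ⟨j, hj⟩ := hc.exists
    exact hj.trans (lintegral_sub_even_pow_stdGaussian_le_of_contDiff (hg1 j) (hg2 j) k)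

end StdGaussian

section Gamma

variable {a r : ℝ}

lemma gammaMeasure_Iic_zero (a r : ℝ) : gammaMeasure a r (Iic 0) = 0 := by
  rw [gammaMeasure, withDensity_apply _ measurableSet_Iic, setLIntegral_congr Iio_ae_eq_Iic.symm,
    lintegral_gammaPDF_of_nonpos le_rfl]

lemma ae_pos_gammaMeasure (a r : ℝ) : ∀ᵐ w ∂gammaMeasure a r, 0 < w := by
  rw [ae_iff]
  simp only [not_lt]
  exact gammaMeasure_Iic_zero a r

lemma lintegral_rpow_mul_exp_gammaMeasure (ha : 0 < a) (hr : 0 < r) {b s : ℝ} (hb : 0 < a + b)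
    (hs : 0 < r + s) :
    ∫⁻ w, ENNReal.ofReal (w ^ b * rexp (-(s * w))) ∂gammaMeasure a r =
      ENNReal.ofReal (r ^ a * Gamma (a + b) / (Gamma a * (r + s) ^ (a + b))) := by
  have hG := Gamma_pos_of_pos ha
  have hG' := Gamma_pos_of_pos hb
  have hm : Measurable (gammaPDF a r) := (measurable_gammaPDFReal a r).ennreal_ofReal
  rw [gammaMeasure, lintegral_withDensity_eq_lintegral_mul _ hm (by fun_prop)]
  have h : ∀ᵐ w : ℝ, (gammaPDF a r * fun w => ENNReal.ofReal (w ^ b * rexp (-(s * w)))) w =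
      ENNReal.ofReal (r ^ a * Gamma (a + b) / (Gamma a * (r + s) ^ (a + b))) *
        gammaPDF (a + b) (r + s) w := by
    filter_upwards [(Measure.ae_ne volume (0 : ℝ))] with w hw
    rcases hw.lt_or_gt with hw | hw
    · simp [gammaPDF_of_neg hw]
    · simp only [Pi.mul_apply]
      rw [gammaPDF_of_nonneg hw.le, gammaPDF_of_nonneg hw.le, ← ENNReal.ofReal_mul (by positivity),
        ← ENNReal.ofReal_mul (by positivity)]
      congr 1
      rw [show a + b - 1 = (a - 1) + b by ring, rpow_add hw,
        show -((r + s) * w) = -(r * w) + -(s * w) by ring, Real.exp_add]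
      field_simp
  rw [lintegral_congr_ae h, lintegral_const_mul' _ _ (by simp), lintegral_gammaPDF_eq_one hb hs,
    mul_one]

lemma lintegral_rpow_gammaMeasure (ha : 0 < a) (hr : 0 < r) {b : ℝ} (hb : 0 < a + b) :
    ∫⁻ w, ENNReal.ofReal (w ^ b) ∂gammaMeasure a r =
      ENNReal.ofReal (Gamma (a + b) / (Gamma a * r ^ b)) := by
  have h := lintegral_rpow_mul_exp_gammaMeasure ha hr hb (s := 0) (by simpa)
  simp only [zero_mul, neg_zero, Real.exp_zero, mul_one, add_zero] at h
  rw [h, rpow_add hr, mul_left_comm, mul_div_mul_left _ _ (by positivity)]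

lemma integrable_rpow_gammaMeasure (ha : 0 < a) (hr : 0 < r) {b : ℝ} (hb : 0 < a + b) :
    Integrable (fun w => w ^ b) (gammaMeasure a r) := by
  rw [← lintegral_ofReal_ne_top_iff_integrable (by fun_prop)
    ((ae_pos_gammaMeasure a r).mono fun w hw => by simp only [Pi.zero_apply]; positivity),
    lintegral_rpow_gammaMeasure ha hr hb]
  simp

lemma integral_rpow_gammaMeasure (ha : 0 < a) (hr : 0 < r) {b : ℝ} (hb : 0 < a + b) :
    ∫ w, w ^ b ∂gammaMeasure a r = Gamma (a + b) / (Gamma a * r ^ b) := by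
  have hG := Gamma_pos_of_pos ha
  have hG' := Gamma_pos_of_pos hb
  rw [integral_eq_lintegral_of_nonneg_ae
    ((ae_pos_gammaMeasure a r).mono fun w hw => by simp only [Pi.zero_apply]; positivity)
    (by fun_prop), lintegral_rpow_gammaMeasure ha hr hb, ENNReal.toReal_ofReal (by positivity)]

lemma integral_rpow_add_one_gammaMeasure (ha : 0 < a) {b : ℝ} (hb : 0 < a + b) :
    ∫ w, w ^ (b + 1) ∂gammaMeasure a a = (1 + b / a) * ∫ w, w ^ b ∂gammaMeasure a a := by
  have hG := Gamma_pos_of_pos ha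
  rw [integral_rpow_gammaMeasure ha ha hb, integral_rpow_gammaMeasure ha ha (by linarith),
    ← add_assoc, Gamma_add_one hb.ne', rpow_add_one ha.ne']
  field_simp

/-- Integration by parts for Laurent polynomials against the gamma distribution of mean one. -/
lemma integral_sub_one_mul_gammaMeasure (ha : 0 < a) {k : ℕ} (hk : k < a) (P : Polynomial ℝ) :
    Integrable (fun w => P.eval w * w ^ (-k : ℝ)) (gammaMeasure a a) ∧
    ∫ w, (w - 1) * (P.eval w * w ^ (-k : ℝ)) ∂gammaMeasure a a =
      a⁻¹ * ∫ w, ((Polynomial.X * P.derivative - k • P).eval w) * w ^ (-k : ℝ)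
        ∂gammaMeasure a a := by
  have hint : ∀ P : Polynomial ℝ,
      Integrable (fun w => P.eval w * w ^ (-k : ℝ)) (gammaMeasure a a) := by
    intro P
    induction P using Polynomial.induction_on' with
    | add p q hp hq =>
      simp only [Polynomial.eval_add, add_mul]
      exact hp.add hq
    | monomial i c =>
      refine ((integrable_rpow_gammaMeasure ha ha (b := i - k) ?_).const_mul c).congr ?_
      · have : (0 : ℝ) ≤ i := i.cast_nonneg
        linarith
      · filter_upwards [ae_pos_gammaMeasure a a] with w hw
        simp only [Polynomial.eval_monomial]
        rw [sub_eq_add_neg, rpow_add hw, rpow_natCast, mul_assoc]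
  refine ⟨hint P, ?_⟩
  have hint' : ∀ P : Polynomial ℝ,
      Integrable (fun w => (w - 1) * (P.eval w * w ^ (-k : ℝ))) (gammaMeasure a a) := fun P => by
    refine (hint ((Polynomial.X - 1) * P)).congr (ae_of_all _ fun w => ?_)
    simp only [Polynomial.eval_mul, Polynomial.eval_sub, Polynomial.eval_X, Polynomial.eval_one,
      mul_assoc]
  induction P using Polynomial.induction_on' with
  | add p q hp hq =>
    have e1 : ∫ w, (w - 1) * ((p + q).eval w * w ^ (-k : ℝ)) ∂gammaMeasure a a =
        ∫ w, (w - 1) * (p.eval w * w ^ (-k : ℝ)) ∂gammaMeasure a a +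
        ∫ w, (w - 1) * (q.eval w * w ^ (-k : ℝ)) ∂gammaMeasure a a := by
      rw [← integral_add (hint' p) (hint' q)]
      refine integral_congr_ae (ae_of_all _ fun w => ?_)
      simp only [Polynomial.eval_add]
      ring
    have e2 : ∫ w, ((Polynomial.X * (p + q).derivative - k • (p + q)).eval w) * w ^ (-k : ℝ)
        ∂gammaMeasure a a =
        ∫ w, ((Polynomial.X * p.derivative - k • p).eval w) * w ^ (-k : ℝ) ∂gammaMeasure a a +
        ∫ w, ((Polynomial.X * q.derivative - k • q).eval w) * w ^ (-k : ℝ) ∂gammaMeasure a a := by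
      rw [← integral_add (hint _) (hint _)]
      refine integral_congr_ae (ae_of_all _ fun w => ?_)
      simp only [Polynomial.derivative_add, Polynomial.eval_sub, Polynomial.eval_mul,
        Polynomial.eval_add, nsmul_eq_mul]
      ring
    rw [e1, e2, hp, hq, mul_add]
  | monomial i c =>
    have hb : 0 < a + (i - k : ℝ) := by
      have : (0 : ℝ) ≤ i := i.cast_nonneg
      linarith
    have e1 : ∫ w, (w - 1) * ((Polynomial.monomial i c).eval w * w ^ (-k : ℝ)) ∂gammaMeasure a a =
        ∫ w, c * (w ^ ((i - k : ℝ) + 1) - w ^ (i - k : ℝ)) ∂gammaMeasure a a := by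
      refine integral_congr_ae ?_
      filter_upwards [ae_pos_gammaMeasure a a] with w hw
      rw [rpow_add_one hw.ne', sub_eq_add_neg (i : ℝ), rpow_add hw, rpow_natCast,
        Polynomial.eval_monomial]
      ring
    have e2 : ∫ w, ((Polynomial.X * (Polynomial.monomial i c).derivative -
        k • Polynomial.monomial i c).eval w) * w ^ (-k : ℝ) ∂gammaMeasure a a =
        ∫ w, (c * (i - k)) * w ^ (i - k : ℝ) ∂gammaMeasure a a := by
      refine integral_congr_ae ?_
      filter_upwards [ae_pos_gammaMeasure a a] with w hw
      have : w * (Polynomial.eval w (Polynomial.derivative (Polynomial.monomial i c))) =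
          i * (c * w ^ i) := by
        rcases i with _ | i
        · simp
        · simp [pow_succ]
          ring
      rw [sub_eq_add_neg (i : ℝ), rpow_add hw, rpow_natCast]
      simp only [Polynomial.eval_sub, Polynomial.eval_mul, Polynomial.eval_X, this,
        Polynomial.eval_natCast, Polynomial.eval_monomial, nsmul_eq_mul]
      ring
    rw [e1, e2, integral_const_mul, integral_const_mul,
      integral_sub (integrable_rpow_gammaMeasure ha ha (by linarith))
        (integrable_rpow_gammaMeasure ha ha hb), integral_rpow_add_one_gammaMeasure ha hb]
    field_simp
    ring

lemma integral_rpow_neg_gammaMeasure_succ (ha : 0 < a) {k : ℕ} (hk : (k + 1 : ℕ) < a) :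
    (a - (k + 1 : ℕ)) * ∫ w, w ^ (-(k + 1 : ℕ) : ℝ) ∂gammaMeasure a a =
      a * ∫ w, w ^ (-k : ℝ) ∂gammaMeasure a a := by
  have h := integral_rpow_add_one_gammaMeasure ha (b := (-(k + 1 : ℕ) : ℝ)) (by linarith)
  rw [show (-(k + 1 : ℕ) : ℝ) + 1 = -k by push_cast; ring] at h
  rw [h]
  field_simp
  ring

lemma integrable_sub_one_pow_gammaMeasure (ha : 0 < a) {k : ℕ} (hk : k < a) (j : ℕ) :
    Integrable (fun w => (w - 1) ^ j * w ^ (-k : ℝ)) (gammaMeasure a a) := by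
  refine (integral_sub_one_mul_gammaMeasure ha hk ((Polynomial.X - 1) ^ j)).1.congr
    (ae_of_all _ fun w => ?_)
  simp only [Polynomial.eval_pow, Polynomial.eval_sub, Polynomial.eval_X, Polynomial.eval_one]

lemma integral_sub_one_pow_gammaMeasure (ha : 0 < a) {k : ℕ} (hk : (k + 1 : ℕ) < a) (j : ℕ) :
    a * ∫ w, (w - 1) ^ (j + 2) * w ^ (-(k + 1 : ℕ) : ℝ) ∂gammaMeasure a a =
      (j + 1) * ∫ w, (w - 1) ^ j * w ^ (-k : ℝ) ∂gammaMeasure a a -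
      (k + 1) * ∫ w, (w - 1) ^ (j + 1) * w ^ (-(k + 1 : ℕ) : ℝ) ∂gammaMeasure a a := by
  have hk' : (k : ℝ) < a := by push_cast at hk; linarith
  have h := (integral_sub_one_mul_gammaMeasure ha hk ((Polynomial.X - 1) ^ (j + 1))).2
  have e1 : ∫ w, (w - 1) * (((Polynomial.X - 1) ^ (j + 1) : Polynomial ℝ).eval w *
      w ^ (-(k + 1 : ℕ) : ℝ)) ∂gammaMeasure a a =
      ∫ w, (w - 1) ^ (j + 2) * w ^ (-(k + 1 : ℕ) : ℝ) ∂gammaMeasure a a := by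
    refine integral_congr_ae (ae_of_all _ fun w => ?_)
    simp only [Polynomial.eval_pow, Polynomial.eval_sub, Polynomial.eval_X, Polynomial.eval_one]
    ring
  have e2 : ∫ w, ((Polynomial.X * ((Polynomial.X - 1) ^ (j + 1) : Polynomial ℝ).derivative -
      (k + 1) • (Polynomial.X - 1) ^ (j + 1)).eval w) * w ^ (-(k + 1 : ℕ) : ℝ)
        ∂gammaMeasure a a =
      (j + 1) * ∫ w, (w - 1) ^ j * w ^ (-k : ℝ) ∂gammaMeasure a a -
      (k + 1) * ∫ w, (w - 1) ^ (j + 1) * w ^ (-(k + 1 : ℕ) : ℝ) ∂gammaMeasure a a := by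
    rw [← integral_const_mul, ← integral_const_mul, ← integral_sub
      ((integrable_sub_one_pow_gammaMeasure ha hk' _).const_mul _)
      ((integrable_sub_one_pow_gammaMeasure ha hk _).const_mul _)]
    refine integral_congr_ae ?_
    filter_upwards [ae_pos_gammaMeasure a a] with w hw
    have : w ^ (-k : ℝ) = w * w ^ (-(k + 1 : ℕ) : ℝ) := by
      rw [show (-k : ℝ) = -(k + 1 : ℕ) + 1 by push_cast; ring, rpow_add_one hw.ne', mul_comm]
    rw [this]
    simp only [Polynomial.derivative_pow, Polynomial.eval_sub, Polynomial.eval_mul,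
      Polynomial.eval_X, Polynomial.eval_one, Polynomial.eval_pow, nsmul_eq_mul,
      Polynomial.eval_natCast, Polynomial.derivative_sub, Polynomial.derivative_X,
      Polynomial.derivative_one, sub_zero, Polynomial.C_eq_natCast, add_tsub_cancel_right]
    push_cast
    ring
  rw [e1, e2] at h
  rw [h, mul_inv_cancel_left₀ ha.ne']

lemma integral_sub_one_even_pow_gammaMeasure_le (ha : 0 < a) {k : ℕ} (hk : (k + 1 : ℕ) < a) :
    (a - (k + 1 : ℕ)) * ∫ w, (w - 1) ^ (2 * (k + 1)) * w ^ (-(k + 1 : ℕ) : ℝ) ∂gammaMeasure a a ≤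
      (3 * k + 2) * ∫ w, (w - 1) ^ (2 * k) * w ^ (-k : ℝ) ∂gammaMeasure a a := by
  have hk' : (k : ℝ) < a := by push_cast at hk; linarith
  have h := integral_sub_one_pow_gammaMeasure ha hk (2 * k)
  have h2 : -∫ w, (w - 1) ^ (2 * k + 1) * w ^ (-(k + 1 : ℕ) : ℝ) ∂gammaMeasure a a ≤
      (∫ w, (w - 1) ^ (2 * k + 2) * w ^ (-(k + 1 : ℕ) : ℝ) ∂gammaMeasure a a) +
      ∫ w, (w - 1) ^ (2 * k) * w ^ (-k : ℝ) ∂gammaMeasure a a := by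
    have i1 := integrable_sub_one_pow_gammaMeasure ha hk (2 * k + 1)
    have i2 := integrable_sub_one_pow_gammaMeasure ha hk (2 * k + 2)
    have i3 := integrable_sub_one_pow_gammaMeasure ha hk' (2 * k)
    rw [← integral_neg, ← integral_add i2 i3]
    refine integral_mono_ae i1.neg (i2.add i3) ?_
    filter_upwards [ae_pos_gammaMeasure a a] with w hw
    have e : w ^ (-k : ℝ) = w * w ^ (-(k + 1 : ℕ) : ℝ) := by
      rw [show (-k : ℝ) = -(k + 1 : ℕ) + 1 by push_cast; ring, rpow_add_one hw.ne', mul_comm]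
    rw [e]
    have : 0 ≤ (w - 1) ^ (2 * k) * w ^ (-(k + 1 : ℕ) : ℝ) * w ^ 2 :=
      mul_nonneg (mul_nonneg ((even_two_mul k).pow_nonneg _) (by positivity)) (by positivity)
    simp only [pow_succ (w - 1)]
    linarith
  push_cast at h h2 ⊢
  rw [show 2 * (k + 1) = 2 * k + 2 by ring]
  have : (0 : ℝ) ≤ k := k.cast_nonneg
  nlinarith

lemma integral_sub_one_sq_gammaMeasure (ha : 1 < a) :
    ∫ w, (w - 1) ^ 2 * w ^ (-(1 : ℕ) : ℝ) ∂gammaMeasure a a = 1 / (a - 1) := by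
  have ha0 : 0 < a := by linarith
  have := isProbabilityMeasure_gammaMeasure ha0 ha0
  have h := integral_sub_one_pow_gammaMeasure ha0 (k := 0) (by simpa using ha) 0
  have h1 := integral_rpow_neg_gammaMeasure_succ ha0 (k := 0) (by simpa using ha)
  have h2 : ∫ w, (w - 1) ^ 1 * w ^ (-(1 : ℕ) : ℝ) ∂gammaMeasure a a =
      1 - ∫ w, w ^ (-(1 : ℕ) : ℝ) ∂gammaMeasure a a := by
    have i1 := integrable_rpow_gammaMeasure ha0 ha0 (b := (-(1 : ℕ) : ℝ)) (by push_cast; linarith)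
    rw [show (1 : ℝ) = ∫ w : ℝ, (1 : ℝ) ∂gammaMeasure a a by simp,
      ← integral_sub (integrable_const _) i1]
    refine integral_congr_ae ?_
    filter_upwards [ae_pos_gammaMeasure a a] with w hw
    push_cast
    rw [rpow_neg_one]
    simp
    field_simp
  simp only [zero_add] at h h1
  rw [h2] at h
  have ha1 : a - 1 ≠ 0 := by linarith
  simp at h h1 ⊢
  have h3 : ∫ w, w ^ (-1 : ℝ) ∂gammaMeasure a a = a / (a - 1) := by
    rw [eq_div_iff ha1]; linarith
  rw [h3] at h
  field_simp at h ⊢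
  nlinarith

end Gamma

section Numerics

lemma prod_mul_le_pow_of_recurrence {a c : ℝ} (hca : c ≤ a) {k : ℕ} (hkc : k < c) {R : ℕ → ℝ}
    (hR0 : R 0 = 1) (hR : ∀ j < k, (a - (j + 1 : ℕ)) * R (j + 1) = a * R j) :
    R k * ∏ i ∈ Finset.range k, (c - (i + 1 : ℕ)) ≤ c ^ k ∧ 0 ≤ R k := by
  induction k with
  | zero => simp [hR0]
  | succ k ih =>
    have hk : (0 : ℝ) ≤ k := k.cast_nonneg
    have hkc' : (k : ℝ) + 1 < c := by exact_mod_cast hkc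
    obtain ⟨h1, h2⟩ := ih (by linarith) fun j hj => hR j (by omega)
    have h3 := hR k (by omega)
    push_cast at h3
    have h4 : 0 < a - (k + 1) := by linarith
    have h5 : R (k + 1) = a * R k / (a - (k + 1)) := by
      rw [eq_div_iff h4.ne', ← h3]; ring
    have h6 : 0 ≤ R (k + 1) := by
      rw [h5]
      exact div_nonneg (mul_nonneg (by linarith) h2) h4.le
    refine ⟨?_, h6⟩
    have h7 : R (k + 1) * (c - (k + 1)) ≤ c * R k := by
      rw [h5, div_mul_eq_mul_div, div_le_iff₀ h4]
      nlinarith [mul_nonneg h2 (mul_nonneg (sub_nonneg.2 hca) (by linarith : 0 ≤ (k : ℝ) + 1))]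
    have h8 : 0 ≤ ∏ i ∈ Finset.range k, (c - (i + 1 : ℕ)) := by
      refine Finset.prod_nonneg fun i hi => ?_
      have : (i : ℝ) + 1 ≤ k := by exact_mod_cast Finset.mem_range.1 hi
      push_cast
      linarith
    rw [Finset.prod_range_succ, pow_succ]
    push_cast at h8 h1 ⊢
    nlinarith

lemma prod_range_odd (k : ℕ) :
    ∏ i ∈ Finset.range k, (2 * (i : ℝ) + 1) = ((2 * k - 1 : ℕ)‼ : ℝ) := by
  induction k with
  | zero => simp
  | succ k ih =>
    rw [Finset.prod_range_succ, ih]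
    rcases k with _ | k
    · simp
    · rw [show 2 * (k + 1 + 1) - 1 = (2 * (k + 1) - 1) + 2 by omega, Nat.doubleFactorial_add_two]
      have : 2 * (k + 1) - 1 + 2 = 2 * (k + 1) + 1 := by omega
      rw [this]
      push_cast
      ring

lemma prod_range_sub_eq (k : ℕ) :
    ∏ i ∈ Finset.range (k + 1), (2 * ((k + 1 : ℕ) : ℝ) - (i + 1 : ℕ)) =
      2 ^ k * ((2 * (k + 1) - 1 : ℕ)‼ : ℝ) := by
  have h1 : ∏ i ∈ Finset.range (k + 1), (2 * ((k + 1 : ℕ) : ℝ) - (i + 1 : ℕ)) =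
      ((2 * k + 1).descFactorial (k + 1) : ℝ) := by
    rw [Nat.descFactorial_eq_prod_range, Nat.cast_prod]
    refine Finset.prod_congr rfl fun i hi => ?_
    rw [Nat.cast_sub (by have := Finset.mem_range.1 hi; omega)]
    push_cast
    ring
  have h2 := Nat.factorial_mul_descFactorial (show k + 1 ≤ 2 * k + 1 by omega)
  rw [show 2 * k + 1 - (k + 1) = k by omega, Nat.factorial_eq_mul_doubleFactorial,
    Nat.doubleFactorial_two_mul] at h2
  have h3 : (2 * k + 1).descFactorial (k + 1) = 2 ^ k * (2 * k + 1)‼ := by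
    refine Nat.eq_of_mul_eq_mul_left k.factorial_pos ?_
    rw [h2]
    ring
  rw [h1, h3, show 2 * (k + 1) - 1 = 2 * k + 1 by omega]
  push_cast
  ring

lemma mul_doubleFactorial_le_of_recurrence {a : ℝ} {k : ℕ} (hk : 1 ≤ k) (ha : 2 * (k : ℝ) ≤ a)
    {R : ℕ → ℝ} (hR0 : R 0 = 1) (hR : ∀ j < k, (a - (j + 1 : ℕ)) * R (j + 1) = a * R j) :
    R k * ((2 * k - 1 : ℕ)‼ : ℝ) ≤ 2 * (k : ℝ) ^ k := by
  obtain ⟨k, rfl⟩ := Nat.exists_eq_add_of_le' hk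
  have hkpos : (0 : ℝ) < (k + 1 : ℕ) := by positivity
  have h := (prod_mul_le_pow_of_recurrence ha (by linarith) hR0 hR).1
  rw [prod_range_sub_eq, mul_pow, pow_succ (2 : ℝ)] at h
  have : (0 : ℝ) < 2 ^ k := by positivity
  refine le_of_mul_le_mul_left ?_ this
  linarith

lemma mul_doubleFactorial_le_five_mul_pow_of_recurrence {a : ℝ} {k : ℕ} (hk : 1 ≤ k)
    (ha : (k : ℝ) + 1 / 4 ≤ a)
    {R : ℕ → ℝ} (hR0 : R 0 = 1) (hR : ∀ j < k, (a - (j + 1 : ℕ)) * R (j + 1) = a * R j) :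
    R k * ((2 * k - 1 : ℕ)‼ : ℝ) ≤ (5 * (k : ℝ)) ^ k := by
  obtain ⟨h, hRk⟩ := prod_mul_le_pow_of_recurrence ha (by linarith) hR0 hR
  have hk1 : (1 : ℝ) ≤ k := by exact_mod_cast hk
  have h1 : ∏ i ∈ Finset.range k, ((k : ℝ) + 1 / 4 - (i + 1 : ℕ)) =
      ∏ i ∈ Finset.range k, ((i : ℝ) + 1 / 4) := by
    rw [← Finset.prod_range_reflect]
    refine Finset.prod_congr rfl fun i hi => ?_
    have := Finset.mem_range.1 hi
    rw [show k - 1 - i + 1 = k - i by omega, Nat.cast_sub (by omega)]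
    ring
  have h2 : ((2 * k - 1 : ℕ)‼ : ℝ) ≤ 4 ^ k * ∏ i ∈ Finset.range k, ((i : ℝ) + 1 / 4) := by
    rw [← prod_range_odd]
    calc _ ≤ ∏ i ∈ Finset.range k, (4 * ((i : ℝ) + 1 / 4)) := by
          refine Finset.prod_le_prod (fun i _ => by positivity) fun i _ => ?_
          have : (0 : ℝ) ≤ i := i.cast_nonneg
          linarith
      _ = _ := by rw [Finset.prod_mul_distrib]; simp
  rw [h1] at h
  calc _ ≤ R k * (4 ^ k * ∏ i ∈ Finset.range k, ((i : ℝ) + 1 / 4)) := by gcongr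
    _ = 4 ^ k * (R k * ∏ i ∈ Finset.range k, ((i : ℝ) + 1 / 4)) := by ring
    _ ≤ 4 ^ k * (k + 1 / 4) ^ k := by gcongr
    _ = (4 * (k + 1 / 4)) ^ k := by rw [mul_pow]
    _ ≤ _ := pow_le_pow_left₀ (by positivity) (by linarith) k

lemma one_add_mul_add_sq_le_pow {x : ℝ} (hx : 0 ≤ x) (k : ℕ) :
    1 + k * x + k * (k - 1) / 2 * x ^ 2 ≤ (1 + x) ^ k := by
  induction k with
  | zero => simp
  | succ k ih =>
    rw [pow_succ (1 + x)]
    have h : 0 ≤ (k : ℝ) * (k - 1) / 2 * x ^ 3 := by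
      rcases k with _ | k
      · simp
      · have : ((k + 1 : ℕ) : ℝ) - 1 = k := by push_cast; ring
        rw [this]
        positivity
    push_cast
    nlinarith [mul_le_mul_of_nonneg_right ih (by linarith : 0 ≤ 1 + x)]

lemma nine_div_four_mul_pow_le {k : ℕ} (hk : 2 ≤ k) :
    9 / 4 * (k : ℝ) ^ k ≤ ((k : ℝ) + 1) ^ k := by
  have hk2 : (2 : ℝ) ≤ k := by exact_mod_cast hk
  have h := one_add_mul_add_sq_le_pow (by positivity : (0 : ℝ) ≤ 1 / k) k
  have e : (k : ℝ) + 1 = (1 + 1 / k) * k := by field_simp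
  rw [e, mul_pow]
  refine mul_le_mul_of_nonneg_right (le_trans ?_ h) (by positivity)
  have : 1 + (k : ℝ) * (1 / k) + k * (k - 1) / 2 * (1 / k) ^ 2 = 2 + (k - 1) / (2 * k) := by
    field_simp; ring
  rw [this]
  have : 1 / 4 ≤ ((k : ℝ) - 1) / (2 * k) := by
    rw [div_le_div_iff₀ (by norm_num) (by positivity)]
    linarith
  linarith

lemma pow_mul_le_of_recurrence {a x : ℝ} {k : ℕ} (hk : 2 ≤ k) (hx : 0 ≤ x)
    (ha : 3 * x ≤ 8 * (a - k)) (hxa : x ≤ 2 * a - 2) (hka : k < a) {S : ℕ → ℝ}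
    (hS0 : ∀ j, 0 ≤ S j) (hS1 : S 1 = 1 / (a - 1))
    (hS : ∀ j < k, (a - (j + 1 : ℕ)) * S (j + 1) ≤ (3 * j + 2) * S j) :
    x ^ k * S k ≤ (3.58 * (k : ℝ)) ^ k := by
  have hk2 : (2 : ℝ) ≤ k := by exact_mod_cast hk
  have step : ∀ j < k, x * S (j + 1) ≤ (8 * j + 16 / 3) * S j := by
    intro j hj
    have hjk : (j : ℝ) + 1 ≤ k := by exact_mod_cast hj
    have h := hS j hj
    push_cast at h
    have h1 : 3 * x * S (j + 1) ≤ 8 * ((a - (j + 1)) * S (j + 1)) := by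
      rw [← mul_assoc]
      exact mul_le_mul_of_nonneg_right (by linarith) (hS0 _)
    linarith
  have h1 : x * S 1 ≤ 2 := by
    rw [hS1, mul_one_div, div_le_iff₀ (by linarith)]
    linarith
  have main : ∀ j, 2 ≤ j → j ≤ k → x ^ j * S j ≤ (3.58 * (j : ℝ)) ^ j := by
    intro j hj
    induction j, hj using Nat.le_induction with
    | base =>
      intro _
      have h2 := step 1 (by omega)
      norm_num at h2 ⊢
      nlinarith
    | succ j hj ih =>
      intro hjk
      have h2 := step j (by omega)
      have h3 := ih (by omega)
      have hj2 : (2 : ℝ) ≤ j := by exact_mod_cast hj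
      have h4 := nine_div_four_mul_pow_le hj
      calc x ^ (j + 1) * S (j + 1) = x ^ j * (x * S (j + 1)) := by ring
        _ ≤ x ^ j * ((8 * j + 16 / 3) * S j) := by gcongr
        _ = (8 * j + 16 / 3) * (x ^ j * S j) := by ring
        _ ≤ (8 * j + 16 / 3) * (3.58 * (j : ℝ)) ^ j := by gcongr
        _ ≤ (3.58 * (j + 1) * (9 / 4)) * (3.58 * (j : ℝ)) ^ j := by
          gcongr
          linarith
        _ = 3.58 ^ (j + 1) * (j + 1) * (9 / 4 * (j : ℝ) ^ j) := by
          rw [mul_pow, pow_succ]; ring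
        _ ≤ 3.58 ^ (j + 1) * (j + 1) * ((j : ℝ) + 1) ^ j := by gcongr
        _ = _ := by push_cast; rw [mul_pow, pow_succ ((j : ℝ) + 1)]; ring
  exact main k hk le_rfl

/-- The two scales whose combination yields the constant `32`. -/
lemma exists_scales_of_recurrence {a x : ℝ} {k : ℕ} (hk : 1 ≤ k) (hx : 0 ≤ x)
    (ha : 2 * (k : ℝ) + x / 4 ≤ a) (hxa : x ≤ 2 * a - 2) {R S : ℕ → ℝ}
    (hR0 : R 0 = 1) (hR : ∀ j < k, (a - (j + 1 : ℕ)) * R (j + 1) = a * R j)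
    (hS0 : ∀ j, 0 ≤ S j) (hS1 : S 1 = 1 / (a - 1))
    (hS : ∀ j < k, (a - (j + 1 : ℕ)) * S (j + 1) ≤ (3 * j + 2) * S j) :
    ∃ A B : ℝ, 0 < A ∧ 0 < B ∧ (A + 2 * B) ^ 2 ≤ 32 * k ∧
      (π / 2) ^ (2 * k) * ((2 * k - 1 : ℕ)‼ : ℝ) * R k ≤ A ^ (2 * k) ∧
      x ^ k * S k ≤ B ^ (2 * k) := by
  have hpi : (π / 2) ^ 2 ≤ 2.4675 := by
    have := pi_lt_d4
    have := pi_pos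
    nlinarith
  have hk1 : (1 : ℝ) ≤ k := by exact_mod_cast hk
  have hRk := mul_doubleFactorial_le_of_recurrence hk (by linarith) hR0 hR
  have scale : ∀ {p q : ℝ}, 0 ≤ p → 0 ≤ q → 0 ≤ (32 - p - 4 * q) →
      16 * p * q ≤ (32 - p - 4 * q) ^ 2 → (√p + 2 * √q) ^ 2 ≤ 32 := by
    intro p q hp hq h1 h2
    have h3 : 4 * (√p * √q) ≤ 32 - p - 4 * q := by
      refine abs_le_of_sq_le_sq' ?_ h1 |>.2
      rw [mul_pow, mul_pow, sq_sqrt hp, sq_sqrt hq]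
      linarith
    nlinarith [sq_sqrt hp, sq_sqrt hq]
  rcases hk.eq_or_lt with rfl | hk2
  · refine ⟨√4.94, √2, by positivity, by positivity, ?_, ?_, ?_⟩
    · have := scale (p := 4.94) (q := 2) (by norm_num) (by norm_num) (by norm_num) (by norm_num)
      simpa using this
    · rw [pow_mul √_, sq_sqrt (by norm_num)]
      norm_num at hRk hpi ⊢
      nlinarith [sq_nonneg (π / 2)]
    · rw [pow_mul √_, sq_sqrt (by norm_num), hS1, pow_one, pow_one, mul_one_div,
        div_le_iff₀ (by norm_num at ha; linarith)]
      linarith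
  · have hk2' : (2 : ℝ) ≤ k := by exact_mod_cast hk2
    refine ⟨√3.49 * √k, √3.58 * √k, by positivity, by positivity, ?_, ?_, ?_⟩
    · have := scale (p := 3.49) (q := 3.58) (by norm_num) (by norm_num) (by norm_num)
        (by norm_num)
      calc _ = (√3.49 + 2 * √3.58) ^ 2 * √k ^ 2 := by ring
        _ ≤ 32 * √k ^ 2 := by gcongr
        _ = _ := by rw [sq_sqrt (by linarith)]
    · rw [← sqrt_mul (by norm_num), pow_mul √_, sq_sqrt (by positivity), pow_mul]
      have h2 : (2 : ℝ) ≤ 1.4143 ^ k :=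
        le_trans (by norm_num) (pow_le_pow_right₀ (by norm_num) hk2)
      have hRk0 : 0 ≤ R k :=
        (prod_mul_le_pow_of_recurrence (show 2 * (k : ℝ) ≤ a by linarith) (by linarith) hR0 hR).2
      calc _ = ((π / 2) ^ 2) ^ k * (R k * ((2 * k - 1 : ℕ)‼ : ℝ)) := by ring
        _ ≤ 2.4675 ^ k * (2 * (k : ℝ) ^ k) := by gcongr
        _ ≤ 2.4675 ^ k * (1.4143 ^ k * (k : ℝ) ^ k) := by gcongr
        _ = (2.4675 * 1.4143 * k) ^ k := by rw [mul_pow, mul_pow]; ring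
        _ ≤ _ := by
          gcongr
          norm_num
    · rw [← sqrt_mul (by norm_num), pow_mul √_, sq_sqrt (by positivity)]
      exact pow_mul_le_of_recurrence hk2 hx (by linarith) hxa (by linarith) hS0 hS1 hS

end Numerics

section Mixture

variable {E : Type*} [NormedAddCommGroup E] [InnerProductSpace ℝ E] [FiniteDimensional ℝ E]
  [MeasurableSpace E] [BorelSpace E]

lemma exists_stdGaussian_eq_withDensity (E : Type*) [NormedAddCommGroup E]
    [InnerProductSpace ℝ E] [FiniteDimensional ℝ E] [MeasurableSpace E] [BorelSpace E] :
    ∃ c : ℝ, 0 < c ∧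
      stdGaussian E = volume.withDensity fun x => ENNReal.ofReal (c * rexp (-(‖x‖ ^ 2 / 2))) := by
  set Z : ℝ := ∫ x : E, rexp (-(‖x‖ ^ 2 / 2)) with hZ
  have hb : (0 : ℝ) < (1 / 2 : ℂ).re := by norm_num
  have key := fun (c : ℂ) (w : E) =>
    GaussianFourier.integral_cexp_neg_mul_sq_norm_add (V := E) hb c w
  have hZC : (Z : ℂ) = (π / (1 / 2 : ℂ)) ^ (Module.finrank ℝ E / 2 : ℂ) := by
    have h := key 0 0
    simp only [zero_mul, add_zero] at h
    rw [hZ, ← integral_complex_ofReal]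
    convert h using 1
    · congr with x
      push_cast
      ring_nf
    · simp
  have hZ0 : Z ≠ 0 := by
    intro h0
    rw [h0] at hZC
    have : (π / (1 / 2 : ℂ)) ^ (Module.finrank ℝ E / 2 : ℂ) ≠ 0 := by
      rw [Complex.cpow_def_of_ne_zero (by simp [pi_ne_zero])]
      exact Complex.exp_ne_zero _
    exact this hZC.symm
  have hZpos : 0 < Z := lt_of_le_of_ne (integral_nonneg fun x => (Real.exp_pos _).le) hZ0.symm
  have hint : Integrable fun x : E => rexp (-(‖x‖ ^ 2 / 2)) := by
    by_contra h
    exact hZ0 (integral_undef h)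
  have hint' : Integrable fun x : E => Z⁻¹ * rexp (-(‖x‖ ^ 2 / 2)) := hint.const_mul _
  refine ⟨Z⁻¹, by positivity, ?_⟩
  have hfin : IsFiniteMeasure
      (volume.withDensity fun x : E => ENNReal.ofReal (Z⁻¹ * rexp (-(‖x‖ ^ 2 / 2)))) :=
    isFiniteMeasure_withDensity_ofReal hint'.2
  refine Measure.ext_of_charFun ?_
  ext t
  rw [charFun_stdGaussian, charFun_apply, integral_withDensity_eq_integral_toReal_smul
    (by fun_prop) (by simp)]
  have h := key Complex.I t
  have e : ∀ x : E, (ENNReal.ofReal (Z⁻¹ * rexp (-(‖x‖ ^ 2 / 2)))).toReal •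
      Complex.exp (⟪x, t⟫ * Complex.I) =
      (Z : ℂ)⁻¹ * Complex.exp (-(1 / 2) * ‖x‖ ^ 2 + Complex.I * ⟪t, x⟫) := by
    intro x
    rw [ENNReal.toReal_ofReal (by positivity), Complex.real_smul, Complex.exp_add,
      real_inner_comm]
    push_cast
    rw [mul_assoc]
    congr 3
    · ring_nf
    · ring
  simp_rw [e]
  rw [integral_const_mul, h, ← hZC, inv_mul_cancel_left₀ (by exact_mod_cast hZ0)]
  congr 1
  simp
  ring

lemma lintegral_smul_withDensity_exp {c s : ℝ} (hs : 0 < s) {g : E → ℝ≥0∞}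
    (hg : Measurable g) :
    ∫⁻ x, g (s • x) ∂(volume : Measure E).withDensity
        (fun x => ENNReal.ofReal (c * rexp (-(‖x‖ ^ 2 / 2)))) =
      ∫⁻ y, ENNReal.ofReal (c * (s ^ Module.finrank ℝ E)⁻¹ * rexp (-(‖y‖ ^ 2 / (2 * s ^ 2)))) *
        g y := by
  rw [lintegral_withDensity_eq_lintegral_mul _ (by fun_prop) (by fun_prop)]
  have e : ∀ x : E, ((fun x : E => ENNReal.ofReal (c * rexp (-(‖x‖ ^ 2 / 2)))) *
      fun x => g (s • x)) x =
      (fun y : E => ENNReal.ofReal (c * rexp (-(‖y‖ ^ 2 / (2 * s ^ 2)))) * g y) (s • x) := by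
    intro x
    simp only [Pi.mul_apply, norm_smul, Real.norm_of_nonneg hs.le]
    congr 5
    field_simp
  simp_rw [e]
  have hm : Measurable fun y : E => ENNReal.ofReal (c * rexp (-(‖y‖ ^ 2 / (2 * s ^ 2)))) * g y := by
    fun_prop
  rw [← lintegral_map (g := fun x : E => s • x) hm (by fun_prop),
    Measure.map_addHaar_smul volume hs.ne', lintegral_smul_measure, smul_eq_mul,
    ← lintegral_const_mul' _ _ (by simp)]
  congr with y
  rw [← mul_assoc, ← ENNReal.ofReal_mul (by positivity),
    abs_of_pos (by positivity)]
  ring_nf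

lemma rpow_neg_half_sq {w : ℝ} (hw : 0 < w) : (w ^ (-(1 / 2) : ℝ)) ^ 2 = w⁻¹ := by
  rw [← rpow_natCast, ← rpow_mul hw.le, ← rpow_neg_one]
  norm_num

lemma tildeCauchyMeasure_eq_map {n : ℕ} {β : ℝ} (hβ : (n : ℝ) < 2 * β) :
    tildeCauchyMeasure n β =
      ((gammaMeasure ((2 * β - n) / 2) ((2 * β - n) / 2)).prod
        (stdGaussian (EuclideanSpace ℝ (Fin n)))).map
          fun p => p.1 ^ (-(1 / 2) : ℝ) • p.2 := by
  set a : ℝ := (2 * β - n) / 2 with ha_def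
  set E := EuclideanSpace ℝ (Fin n)
  have ha : 0 < a := by rw [ha_def]; linarith
  have hd : 2 * β - n = 2 * a := by rw [ha_def]; ring
  have hβ0 : 0 < β := by have : (0 : ℝ) ≤ n := n.cast_nonneg; linarith
  have hγ := isProbabilityMeasure_gammaMeasure ha ha
  obtain ⟨c, hc, hG⟩ := exists_stdGaussian_eq_withDensity E
  have hmeas : Measurable fun p : ℝ × E => p.1 ^ (-(1 / 2) : ℝ) • p.2 := by fun_prop
  set ν : Measure E := ((gammaMeasure a a).prod (stdGaussian E)).map
    fun p => p.1 ^ (-(1 / 2) : ℝ) • p.2 with hν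
  have hνp : IsProbabilityMeasure ν := Measure.isProbabilityMeasure_map hmeas.aemeasurable
  set ρ : E → ℝ := fun y => (1 + ‖y‖ ^ 2 / (2 * β - n)) ^ (-β) with hρ
  have hρ0 : ∀ y, 0 ≤ ρ y := fun y => by
    have : 0 < 2 * β - n := by linarith
    simp only [hρ]
    positivity
  have hρm : Measurable ρ := by fun_prop
  obtain ⟨K, hK, h⟩ : ∃ K : ℝ, 0 < K ∧ ∀ g : E → ℝ≥0∞, Measurable g →
      ∫⁻ x, g x ∂ν = ENNReal.ofReal K * ∫⁻ y, ENNReal.ofReal (ρ y) * g y := by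
    have hΓ := Gamma_pos_of_pos ha
    have hΓ' := Gamma_pos_of_pos hβ0
    refine ⟨c * (a ^ a * Gamma β / (Gamma a * a ^ β)), by positivity, fun g hg => ?_⟩
    rw [hν, lintegral_map hg hmeas, lintegral_prod _ (by fun_prop), hG]
    have e1 : ∀ᵐ w ∂gammaMeasure a a,
        ∫⁻ y, g (w ^ (-(1 / 2) : ℝ) • y) ∂(volume : Measure E).withDensity
        (fun x => ENNReal.ofReal (c * rexp (-(‖x‖ ^ 2 / 2)))) =
        ∫⁻ y, ENNReal.ofReal c * (ENNReal.ofReal (w ^ ((n : ℝ) / 2) *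
          rexp (-(‖y‖ ^ 2 / 2 * w))) * g y) := by
      filter_upwards [ae_pos_gammaMeasure a a] with w hw
      rw [lintegral_smul_withDensity_exp (by positivity) hg]
      congr with y
      rw [← mul_assoc, ← ENNReal.ofReal_mul hc.le, mul_assoc c]
      congr 4
      · rw [finrank_euclideanSpace_fin, ← rpow_natCast, ← rpow_mul hw.le, ← rpow_neg hw.le]
        congr 1
        ring
      · rw [rpow_neg_half_sq hw]
        field_simp
    rw [lintegral_congr_ae e1, lintegral_lintegral_swap (by fun_prop),
      ← lintegral_const_mul' _ _ (by simp)]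
    congr with y
    rw [lintegral_const_mul' _ _ (by simp), lintegral_mul_const _ (by fun_prop),
      lintegral_rpow_mul_exp_gammaMeasure ha ha (by positivity) (by positivity), ← mul_assoc,
      ← mul_assoc, ← ENNReal.ofReal_mul hc.le, ← ENNReal.ofReal_mul (by positivity)]
    congr 2
    rw [mul_assoc]
    congr 1
    have e2 : a + ‖y‖ ^ 2 / 2 = a * (1 + ‖y‖ ^ 2 / (2 * β - n)) := by
      rw [hd]; field_simp
    have e3 : a + (n : ℝ) / 2 = β := by rw [ha_def]; ring
    have h1 : 0 < 1 + ‖y‖ ^ 2 / (2 * β - n) := by rw [hd]; positivity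
    simp only [hρ]
    rw [e3, e2, mul_rpow ha.le h1.le, rpow_neg h1.le]
    field_simp
  have h1 := h 1 measurable_one
  simp only [Pi.one_apply, lintegral_one, measure_univ, mul_one] at h1
  have hρi : ∫ y, ρ y = K⁻¹ := by
    rw [integral_eq_lintegral_of_nonneg_ae (ae_of_all _ hρ0) hρm.aestronglyMeasurable]
    rw [mul_comm] at h1
    rw [ENNReal.eq_inv_of_mul_eq_one_left h1.symm, ENNReal.toReal_inv, ENNReal.toReal_ofReal hK.le]
  ext s hs
  rw [tildeCauchyMeasure, withDensity_apply _ hs, ← lintegral_indicator_one hs, h _ (by fun_prop),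
    ← lintegral_const_mul' _ _ (by simp), ← lintegral_indicator hs]
  congr with y
  rw [show (∫ y : E, (1 + ‖y‖ ^ 2 / (2 * β - n)) ^ (-β)) = K⁻¹ from hρi]
  by_cases hy : y ∈ s
  · simp only [hy, indicator_of_mem, Pi.one_apply, mul_one]
    rw [← ENNReal.ofReal_mul hK.le, div_inv_eq_mul, mul_comm K]
  · simp [hy]

end Mixture

section Moments

lemma add_even_pow_le {A B : ℝ} (hA : 0 < A) (hB : 0 < B) (u v : ℝ) (k : ℕ) :
    (u + v) ^ (2 * k) ≤ (A + B) ^ (2 * k) * (A / (A + B) * (A ^ (2 * k))⁻¹) * u ^ (2 * k) +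
      (A + B) ^ (2 * k) * (B / (A + B) * (B ^ (2 * k))⁻¹) * v ^ (2 * k) := by
  have h := (even_two_mul k).convexOn_pow (𝕜 := ℝ) |>.2 (mem_univ (u / A)) (mem_univ (v / B))
    (by positivity : 0 ≤ A / (A + B)) (by positivity : 0 ≤ B / (A + B)) (by field_simp)
  simp only [smul_eq_mul] at h
  have e : u + v = (A + B) * (A / (A + B) * (u / A) + B / (A + B) * (v / B)) := by field_simp
  rw [e, mul_pow]
  refine (mul_le_mul_of_nonneg_left h (by positivity)).trans_eq ?_
  rw [div_pow, div_pow, mul_add]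
  ring

/-- Minkowski's inequality for even powers. -/
lemma lintegral_add_even_pow_le {Ω : Type*} [MeasurableSpace Ω] {μ : Measure Ω} {u v : Ω → ℝ}
    (hu : Measurable u) {A B : ℝ} (hA : 0 < A) (hB : 0 < B) {k : ℕ}
    (hA' : ∫⁻ x, ENNReal.ofReal (u x ^ (2 * k)) ∂μ ≤ ENNReal.ofReal (A ^ (2 * k)))
    (hB' : ∫⁻ x, ENNReal.ofReal (v x ^ (2 * k)) ∂μ ≤ ENNReal.ofReal (B ^ (2 * k))) :
    ∫⁻ x, ENNReal.ofReal ((u x + v x) ^ (2 * k)) ∂μ ≤ ENNReal.ofReal ((A + B) ^ (2 * k)) := by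
  set C := (A + B) ^ (2 * k) * (A / (A + B) * (A ^ (2 * k))⁻¹) with hC
  set D := (A + B) ^ (2 * k) * (B / (A + B) * (B ^ (2 * k))⁻¹) with hD
  have hC0 : 0 ≤ C := by positivity
  have hD0 : 0 ≤ D := by positivity
  calc _ ≤ ∫⁻ x, (ENNReal.ofReal C * ENNReal.ofReal (u x ^ (2 * k)) +
        ENNReal.ofReal D * ENNReal.ofReal (v x ^ (2 * k))) ∂μ := by
        refine lintegral_mono fun x => ?_
        have hux : 0 ≤ u x ^ (2 * k) := (even_two_mul k).pow_nonneg _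
        have hvx : 0 ≤ v x ^ (2 * k) := (even_two_mul k).pow_nonneg _
        rw [← ENNReal.ofReal_mul hC0, ← ENNReal.ofReal_mul hD0,
          ← ENNReal.ofReal_add (by positivity) (by positivity)]
        exact ENNReal.ofReal_le_ofReal (add_even_pow_le hA hB _ _ _)
    _ = ENNReal.ofReal C * ∫⁻ x, ENNReal.ofReal (u x ^ (2 * k)) ∂μ +
        ENNReal.ofReal D * ∫⁻ x, ENNReal.ofReal (v x ^ (2 * k)) ∂μ := by
        rw [lintegral_add_left (by fun_prop), lintegral_const_mul' _ _ (by simp),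
          lintegral_const_mul' _ _ (by simp)]
    _ ≤ ENNReal.ofReal C * ENNReal.ofReal (A ^ (2 * k)) +
        ENNReal.ofReal D * ENNReal.ofReal (B ^ (2 * k)) := by gcongr
    _ = _ := by
        rw [← ENNReal.ofReal_mul hC0, ← ENNReal.ofReal_mul hD0,
          ← ENNReal.ofReal_add (by positivity) (by positivity), hC, hD]
        congr 1
        field_simp

lemma LipschitzWith.integrable_of_integrable_norm {E : Type*} [NormedAddCommGroup E]
    [MeasurableSpace E] [BorelSpace E] {μ : Measure E} [IsFiniteMeasure μ]
    {f : E → ℝ} {C : ℝ≥0} (hf : LipschitzWith C f) (hμ : Integrable (fun x => ‖x‖) μ) :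
    Integrable f μ := by
  refine ((hμ.const_mul C).add (integrable_const ‖f 0‖)).mono'
    hf.continuous.aestronglyMeasurable (ae_of_all _ fun x => ?_)
  have := hf.dist_le_mul x 0
  rw [dist_zero_right, dist_eq_norm] at this
  have h2 := norm_add_le (f x - f 0) (f 0)
  rw [sub_add_cancel] at h2
  simp only [Pi.add_apply]
  linarith

variable {n : ℕ} {f : EuclideanSpace ℝ (Fin n) → ℝ}

local notation "𝔼" => EuclideanSpace ℝ (Fin n)

lemma integrable_norm_stdGaussian : Integrable (fun x => ‖x‖) (stdGaussian 𝔼) :=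
  IsGaussian.integrable_id.norm

lemma integral_norm_stdGaussian_sq_le : (∫ x, ‖x‖ ∂stdGaussian 𝔼) ^ 2 ≤ n := by
  have h1 := ofReal_integral_even_pow_le (integrable_norm_stdGaussian (n := n)) 1
  have h2 := h1.trans (lintegral_norm_pow_stdGaussian_le n 1)
  rw [ENNReal.ofReal_le_ofReal_iff (by positivity)] at h2
  simpa using h2

lemma lipschitzWith_comp_smul (hf : LipschitzWith 1 f) (s : ℝ) :
    LipschitzWith ‖s‖₊ fun x => f (s • x) := by
  have h := hf.comp (lipschitzWith_smul s)
  rw [one_mul] at h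
  exact h

lemma integrable_comp_smul_stdGaussian (hf : LipschitzWith 1 f) (s : ℝ) :
    Integrable (fun x => f (s • x)) (stdGaussian 𝔼) :=
  (lipschitzWith_comp_smul hf s).integrable_of_integrable_norm integrable_norm_stdGaussian

lemma lintegral_integral_sub_even_pow_stdGaussian_le (hf : LipschitzWith 1 f) {s : ℝ} (hs : 0 < s)
    (k : ℕ) :
    ∫⁻ x, ENNReal.ofReal (((∫ y, f (s • y) ∂stdGaussian 𝔼) - f (s • x)) ^ (2 * k))
      ∂stdGaussian 𝔼 ≤
      ENNReal.ofReal (s ^ (2 * k) * ((π / 2) ^ (2 * k) * ((2 * k - 1 : ℕ)‼ : ℝ))) := by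
  set h : 𝔼 → ℝ := fun x => s⁻¹ * f (s • x) with hh
  have hL : LipschitzWith 1 h := by
    refine LipschitzWith.of_dist_le_mul fun x y => ?_
    have := hf.dist_le_mul (s • x) (s • y)
    rw [dist_smul₀, Real.norm_of_nonneg hs.le] at this
    rw [hh, Real.dist_eq, ← mul_sub, abs_mul, abs_of_pos (by positivity), ← Real.dist_eq]
    rw [inv_mul_le_iff₀ hs]
    linarith
  have hm : Measurable fun z : 𝔼 × 𝔼 => ENNReal.ofReal ((h z.2 - h z.1) ^ (2 * k)) :=
    ((hL.continuous.comp continuous_snd).sub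
      (hL.continuous.comp continuous_fst)).measurable.pow_const (2 * k) |>.ennreal_ofReal
  calc _ ≤ ∫⁻ x, ENNReal.ofReal (s ^ (2 * k)) *
        (∫⁻ y, ENNReal.ofReal ((h y - h x) ^ (2 * k)) ∂stdGaussian 𝔼) ∂stdGaussian 𝔼 := by
        refine lintegral_mono fun x => ?_
        have hi := integrable_comp_smul_stdGaussian hf s
        have e : (∫ y, f (s • y) ∂stdGaussian 𝔼) - f (s • x) =
            ∫ y, (f (s • y) - f (s • x)) ∂stdGaussian 𝔼 := by
          rw [integral_sub hi (integrable_const _)]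
          simp
        dsimp only
        rw [e]
        refine (ofReal_integral_even_pow_le (hi.sub (integrable_const _)) k).trans_eq ?_
        rw [← lintegral_const_mul' _ _ (by simp)]
        congr with y
        rw [← ENNReal.ofReal_mul (by positivity), ← mul_pow]
        simp only [hh, Pi.sub_apply]
        congr 2
        field_simp
    _ = ENNReal.ofReal (s ^ (2 * k)) * ∫⁻ z, ENNReal.ofReal ((h z.2 - h z.1) ^ (2 * k))
        ∂(stdGaussian 𝔼).prod (stdGaussian 𝔼) := by
        rw [lintegral_const_mul' _ _ (by simp), lintegral_prod _ hm.aemeasurable]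
    _ ≤ _ := by
        rw [ENNReal.ofReal_mul (by positivity)]
        gcongr
        exact lintegral_sub_even_pow_stdGaussian_le hL k

lemma sq_integral_comp_smul_stdGaussian_sub_le (hf : LipschitzWith 1 f) (s : ℝ) :
    ((∫ y, f y ∂stdGaussian 𝔼) - ∫ y, f (s • y) ∂stdGaussian 𝔼) ^ 2 ≤ n * (s - 1) ^ 2 := by
  have h1 : |(∫ y, f y ∂stdGaussian 𝔼) - ∫ y, f (s • y) ∂stdGaussian 𝔼| ≤
      |s - 1| * ∫ y, ‖y‖ ∂stdGaussian 𝔼 := by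
    rw [← integral_sub (hf.integrable_of_integrable_norm integrable_norm_stdGaussian)
      (integrable_comp_smul_stdGaussian hf s), ← integral_const_mul, ← Real.norm_eq_abs]
    refine norm_integral_le_of_norm_le (integrable_norm_stdGaussian.const_mul _)
      (ae_of_all _ fun y => ?_)
    rw [← dist_eq_norm]
    refine (hf.dist_le_mul _ _).trans_eq ?_
    rw [NNReal.coe_one, one_mul, dist_comm, dist_eq_norm,
      show s • y - y = (s - 1) • y by rw [sub_smul, one_smul], norm_smul, Real.norm_eq_abs]
  rw [← sq_abs]
  calc _ ≤ (|s - 1| * ∫ y, ‖y‖ ∂stdGaussian 𝔼) ^ 2 := by gcongr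
    _ = (∫ y, ‖y‖ ∂stdGaussian 𝔼) ^ 2 * (s - 1) ^ 2 := by rw [mul_pow, sq_abs, mul_comm]
    _ ≤ _ := by
      gcongr
      exact integral_norm_stdGaussian_sq_le

lemma sq_rpow_neg_half_sub_one_le {w : ℝ} (hw : 0 < w) :
    (w ^ (-(1 / 2) : ℝ) - 1) ^ 2 ≤ (w - 1) ^ 2 * w⁻¹ := by
  have hs : 0 < √w := sqrt_pos.2 hw
  rw [rpow_neg hw.le, ← sqrt_eq_rpow]
  have e : (w - 1) ^ 2 * w⁻¹ = ((√w)⁻¹ - 1) ^ 2 * (1 + √w) ^ 2 := by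
    have : w = √w ^ 2 := (sq_sqrt hw.le).symm
    rw [this, sqrt_sq hs.le]
    field_simp
    ring
  rw [e]
  refine le_mul_of_one_le_right (sq_nonneg _) ?_
  nlinarith

lemma integral_comp_smul_stdGaussian_sub_even_pow_le (hf : LipschitzWith 1 f) {w : ℝ} (hw : 0 < w)
    (k : ℕ) :
    ((∫ y, f y ∂stdGaussian 𝔼) - ∫ y, f (w ^ (-(1 / 2) : ℝ) • y) ∂stdGaussian 𝔼) ^ (2 * k) ≤
      n ^ k * ((w - 1) ^ (2 * k) * w ^ (-k : ℝ)) := by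
  rw [pow_mul]
  have h1 := sq_integral_comp_smul_stdGaussian_sub_le hf (w ^ (-(1 / 2) : ℝ))
  have h2 := sq_rpow_neg_half_sub_one_le hw
  have h3 := h1.trans (mul_le_mul_of_nonneg_left h2 n.cast_nonneg)
  refine (pow_le_pow_left₀ (sq_nonneg _) h3 k).trans_eq ?_
  rw [mul_pow, mul_pow, ← pow_mul, rpow_neg hw.le, rpow_natCast, inv_pow]

end Moments

section TildeCauchy

variable {n : ℕ} {β : ℝ} {f : EuclideanSpace ℝ (Fin n) → ℝ}

local notation "𝔼" => EuclideanSpace ℝ (Fin n)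

lemma isProbabilityMeasure_tildeCauchyMeasure (hβ : (n : ℝ) < 2 * β) :
    IsProbabilityMeasure (tildeCauchyMeasure n β) := by
  have ha : 0 < (2 * β - n) / 2 := by linarith
  have := isProbabilityMeasure_gammaMeasure ha ha
  rw [tildeCauchyMeasure_eq_map hβ]
  exact Measure.isProbabilityMeasure_map (by fun_prop)

lemma lintegral_tildeCauchyMeasure (hβ : (n : ℝ) < 2 * β) {g : 𝔼 → ℝ≥0∞} (hg : Measurable g) :
    ∫⁻ x, g x ∂tildeCauchyMeasure n β =
      ∫⁻ w, (∫⁻ x, g (w ^ (-(1 / 2) : ℝ) • x) ∂stdGaussian 𝔼)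
        ∂gammaMeasure ((2 * β - n) / 2) ((2 * β - n) / 2) := by
  rw [tildeCauchyMeasure_eq_map hβ, lintegral_map hg (by fun_prop),
    lintegral_prod _ (by fun_prop)]

lemma lintegral_rpow_neg_half_pow_gammaMeasure {a : ℝ} (ha : 0 < a) {k : ℕ} (hk : (k : ℝ) < a) :
    ∫⁻ w, ENNReal.ofReal ((w ^ (-(1 / 2) : ℝ)) ^ (2 * k)) ∂gammaMeasure a a =
      ENNReal.ofReal (∫ w, w ^ (-k : ℝ) ∂gammaMeasure a a) := by
  have hk' : 0 < a + (-k : ℝ) := by linarith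
  rw [integral_rpow_gammaMeasure ha ha hk', ← lintegral_rpow_gammaMeasure ha ha hk']
  refine lintegral_congr_ae ?_
  filter_upwards [ae_pos_gammaMeasure a a] with w hw
  rw [pow_mul, rpow_neg_half_sq hw, rpow_neg hw.le, rpow_natCast, inv_pow]

lemma lintegral_norm_pow_tildeCauchyMeasure_le (hβ : (n : ℝ) < 2 * β) {k : ℕ}
    (hk : (k : ℝ) < (2 * β - n) / 2) :
    ∫⁻ x, ENNReal.ofReal (‖x‖ ^ (2 * k)) ∂tildeCauchyMeasure n β ≤
      ENNReal.ofReal ((∫ w, w ^ (-k : ℝ) ∂gammaMeasure ((2 * β - n) / 2) ((2 * β - n) / 2)) *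
        ((n : ℝ) ^ k * ((2 * k - 1 : ℕ)‼ : ℝ))) := by
  have ha : 0 < (2 * β - n) / 2 := by linarith
  rw [lintegral_tildeCauchyMeasure hβ (by fun_prop)]
  set a := (2 * β - n) / 2
  calc _ ≤ ∫⁻ w, ENNReal.ofReal ((w ^ (-(1 / 2) : ℝ)) ^ (2 * k)) *
        ENNReal.ofReal ((n : ℝ) ^ k * ((2 * k - 1 : ℕ)‼ : ℝ)) ∂gammaMeasure a a := by
        refine lintegral_mono_ae ?_
        filter_upwards [ae_pos_gammaMeasure a a] with w hw
        refine le_trans ?_ (mul_le_mul_right (lintegral_norm_pow_stdGaussian_le n k) _)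
        rw [← lintegral_const_mul' _ _ (by simp)]
        refine (lintegral_congr fun x => ?_).le
        rw [norm_smul, mul_pow, ENNReal.ofReal_mul (by positivity),
          Real.norm_of_nonneg (by positivity)]
    _ = _ := by
        rw [lintegral_mul_const _ (by fun_prop), lintegral_rpow_neg_half_pow_gammaMeasure ha hk,
          ← ENNReal.ofReal_mul' (by positivity)]

lemma integrable_tildeCauchyMeasure (hβ : (n : ℝ) < 2 * β) (h1 : 1 < (2 * β - n) / 2)
    (hf : LipschitzWith 1 f) : Integrable f (tildeCauchyMeasure n β) := by
  have := isProbabilityMeasure_tildeCauchyMeasure hβ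
  refine hf.integrable_of_integrable_norm ?_
  have h2 := (lintegral_norm_pow_tildeCauchyMeasure_le hβ (k := 1) (by simpa using h1)).trans_lt
    ENNReal.ofReal_lt_top
  have h3 : MemLp (fun x : 𝔼 => ‖x‖) 2 (tildeCauchyMeasure n β) := by
    refine (memLp_two_iff_integrable_sq (by fun_prop)).2 ?_
    refine (lintegral_ofReal_ne_top_iff_integrable (by fun_prop)
      (ae_of_all _ fun x => sq_nonneg _)).1 ?_
    simpa using h2.ne
  exact h3.integrable (by norm_num)

lemma lintegral_norm_pow_tildeCauchyMeasure_le_pow (hβ : (n : ℝ) < 2 * β) {k : ℕ} (hk : 1 ≤ k)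
    (hk' : (k : ℝ) + 1 / 4 ≤ (2 * β - n) / 2) (hn : n ≤ 4 * k) :
    ∫⁻ x, ENNReal.ofReal (‖x‖ ^ (2 * k)) ∂tildeCauchyMeasure n β ≤
      ENNReal.ofReal ((√20 * k) ^ (2 * k)) := by
  have ha : 0 < (2 * β - n) / 2 := by linarith
  refine (lintegral_norm_pow_tildeCauchyMeasure_le hβ (by linarith)).trans
    (ENNReal.ofReal_le_ofReal ?_)
  set a := (2 * β - n) / 2
  have := isProbabilityMeasure_gammaMeasure ha ha
  have h := mul_doubleFactorial_le_five_mul_pow_of_recurrence hk hk'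
    (R := fun j => ∫ w, w ^ (-j : ℝ) ∂gammaMeasure a a) (by simp) (fun j hj => by
      refine integral_rpow_neg_gammaMeasure_succ ha ?_
      have : ((j + 1 : ℕ) : ℝ) ≤ k := by exact_mod_cast hj
      linarith)
  have hn' : (n : ℝ) ≤ 4 * k := by exact_mod_cast hn
  calc _ = (n : ℝ) ^ k * ((∫ w, w ^ (-k : ℝ) ∂gammaMeasure a a) * ((2 * k - 1 : ℕ)‼ : ℝ)) := by
        ring
    _ ≤ (n : ℝ) ^ k * (5 * (k : ℝ)) ^ k := by gcongr
    _ ≤ (4 * (k : ℝ)) ^ k * (5 * (k : ℝ)) ^ k := by gcongr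
    _ = _ := by
        rw [pow_mul, mul_pow √20, sq_sqrt (by norm_num), ← mul_pow]
        ring_nf

lemma lintegral_even_pow_tildeCauchyMeasure_le_pow (hβ : (n : ℝ) < 2 * β) {k : ℕ} (hk : 1 ≤ k)
    (hk' : (k : ℝ) + 1 / 4 ≤ (2 * β - n) / 2) (hn : n ≤ 4 * k) (hf : LipschitzWith 1 f)
    (hf0 : ∫ x, f x ∂tildeCauchyMeasure n β = 0) :
    ∫⁻ x, ENNReal.ofReal (f x ^ (2 * k)) ∂tildeCauchyMeasure n β ≤
      ENNReal.ofReal ((80 * (k : ℝ) ^ 2) ^ k) := by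
  have := isProbabilityMeasure_tildeCauchyMeasure hβ
  have hk1 : (1 : ℝ) ≤ k := by exact_mod_cast hk
  have hpos : (0 : ℝ) < √20 * k := by positivity
  have hi := integrable_tildeCauchyMeasure hβ (by linarith) hf
  have h1 : ∫⁻ x, ENNReal.ofReal ((f x - f 0) ^ (2 * k)) ∂tildeCauchyMeasure n β ≤
      ENNReal.ofReal ((√20 * k) ^ (2 * k)) := by
    refine le_trans (lintegral_mono fun x => ENNReal.ofReal_le_ofReal ?_)
      (lintegral_norm_pow_tildeCauchyMeasure_le_pow hβ hk hk' hn)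
    rw [← (even_two_mul k).pow_abs]
    refine pow_le_pow_left₀ (abs_nonneg _) ?_ _
    simpa using hf.norm_sub_le x 0
  have h2 : ∫⁻ x, ENNReal.ofReal (f 0 ^ (2 * k)) ∂tildeCauchyMeasure n β ≤
      ENNReal.ofReal ((√20 * k) ^ (2 * k)) := by
    refine le_trans ?_ h1
    have h3 := ofReal_integral_even_pow_le (hi.sub (integrable_const (f 0))) k
    simp only [Pi.sub_apply] at h3
    rw [integral_sub hi (integrable_const _), hf0] at h3
    simpa [(even_two_mul k).neg_pow] using h3
  have h := lintegral_add_even_pow_le (hf.continuous.measurable.sub_const (f 0)) hpos hpos h1 h2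
  simp only [sub_add_cancel] at h
  refine h.trans_eq ?_
  rw [pow_mul, ← two_mul, mul_pow 2, mul_pow √20, sq_sqrt (by norm_num)]
  ring_nf

lemma lintegral_even_pow_tildeCauchyMeasure_le (hβ : (n : ℝ) + 2 ≤ 2 * β - n) {k : ℕ} (hk : 1 ≤ k)
    (hk' : 2 * (k : ℝ) + n / 4 ≤ (2 * β - n) / 2) (hf : LipschitzWith 1 f)
    (hf0 : ∫ x, f x ∂tildeCauchyMeasure n β = 0) :
    ∫⁻ x, ENNReal.ofReal (f x ^ (2 * k)) ∂tildeCauchyMeasure n β ≤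
      ENNReal.ofReal ((32 * (k : ℝ)) ^ k) := by
  have hn : (0 : ℝ) ≤ n := n.cast_nonneg
  have hk1 : (1 : ℝ) ≤ k := by exact_mod_cast hk
  have hβ' : (n : ℝ) < 2 * β := by linarith
  have hi := integrable_tildeCauchyMeasure hβ' (by linarith) hf
  have ha : 0 < (2 * β - n) / 2 := by linarith
  have hμ := tildeCauchyMeasure_eq_map hβ'
  set a := (2 * β - n) / 2 with ha_def
  have := isProbabilityMeasure_gammaMeasure ha ha
  set γ := gammaMeasure a a with hγ
  set G := stdGaussian 𝔼
  set R : ℕ → ℝ := fun j => ∫ w, w ^ (-j : ℝ) ∂γ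
  set S : ℕ → ℝ := fun j => ∫ w, (w - 1) ^ (2 * j) * w ^ (-j : ℝ) ∂γ
  have hlt : ∀ j < k, ((j + 1 : ℕ) : ℝ) < a := fun j hj => by
    have : ((j + 1 : ℕ) : ℝ) ≤ k := by exact_mod_cast hj
    linarith
  obtain ⟨A, B, hA, hB, hAB, hRA, hSB⟩ := exists_scales_of_recurrence (R := R) (S := S) (x := n)
    hk hn hk' (by rw [ha_def]; linarith) (by simp [R])
    (fun j hj => integral_rpow_neg_gammaMeasure_succ ha (hlt j hj))
    (fun j => integral_nonneg_of_ae <| (ae_pos_gammaMeasure a a).mono fun w hw =>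
      mul_nonneg ((even_two_mul j).pow_nonneg _) (by positivity))
    (integral_sub_one_sq_gammaMeasure (by linarith))
    (fun j hj => integral_sub_one_even_pow_gammaMeasure_le ha (hlt j hj))
  set X : ℝ × 𝔼 → 𝔼 := fun p => p.1 ^ (-(1 / 2) : ℝ) • p.2 with hX
  have hXm : Measurable X := by fun_prop
  have hfm : Measurable f := hf.continuous.measurable
  set I : ℝ → ℝ := fun w => ∫ y, f (w ^ (-(1 / 2) : ℝ) • y) ∂G with hI
  set c : ℝ := ∫ y, f y ∂G with hc
  have hIm : Measurable I :=
    (hfm.comp hXm).stronglyMeasurable.integral_prod_right'.measurable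
  have hu : ∫⁻ p, ENNReal.ofReal ((I p.1 - f (X p)) ^ (2 * k)) ∂γ.prod G ≤
      ENNReal.ofReal (A ^ (2 * k)) := by
    rw [lintegral_prod _ (by fun_prop)]
    calc _ ≤ ∫⁻ w, ENNReal.ofReal ((w ^ (-(1 / 2) : ℝ)) ^ (2 * k)) *
          ENNReal.ofReal ((π / 2) ^ (2 * k) * ((2 * k - 1 : ℕ)‼ : ℝ)) ∂γ := by
          refine lintegral_mono_ae ?_
          filter_upwards [ae_pos_gammaMeasure a a] with w hw
          rw [← ENNReal.ofReal_mul (by positivity)]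
          exact lintegral_integral_sub_even_pow_stdGaussian_le hf (by positivity) k
      _ = ENNReal.ofReal ((π / 2) ^ (2 * k) * ((2 * k - 1 : ℕ)‼ : ℝ) * R k) := by
          rw [lintegral_mul_const _ (by fun_prop),
            lintegral_rpow_neg_half_pow_gammaMeasure ha (by linarith),
            ← ENNReal.ofReal_mul' (by positivity), mul_comm]
      _ ≤ _ := ENNReal.ofReal_le_ofReal hRA
  have hv : ∫⁻ w, ENNReal.ofReal ((c - I w) ^ (2 * k)) ∂γ ≤ ENNReal.ofReal (B ^ (2 * k)) := by
    have hSi := (integrable_sub_one_pow_gammaMeasure ha (k := k) (by linarith) (2 * k)).const_mul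
      ((n : ℝ) ^ k)
    calc _ ≤ ∫⁻ w, ENNReal.ofReal ((n : ℝ) ^ k * ((w - 1) ^ (2 * k) * w ^ (-k : ℝ))) ∂γ := by
          refine lintegral_mono_ae ?_
          filter_upwards [ae_pos_gammaMeasure a a] with w hw
          exact ENNReal.ofReal_le_ofReal
            (integral_comp_smul_stdGaussian_sub_even_pow_le hf hw k)
      _ = ENNReal.ofReal ((n : ℝ) ^ k * S k) := by
          rw [← ofReal_integral_eq_lintegral_ofReal hSi, integral_const_mul]
          exact (ae_pos_gammaMeasure a a).mono fun w hw =>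
            mul_nonneg (by positivity) (mul_nonneg ((even_two_mul k).pow_nonneg _) (by positivity))
      _ ≤ _ := ENNReal.ofReal_le_ofReal hSB
  have hIint : Integrable I γ ∧ ∫ w, I w ∂γ = 0 := by
    rw [hμ] at hi hf0
    have hi' : Integrable (fun p => f (X p)) (γ.prod G) :=
      (integrable_map_measure hfm.aestronglyMeasurable hXm.aemeasurable).1 hi
    rw [integral_map hXm.aemeasurable hfm.aestronglyMeasurable, integral_prod _ hi'] at hf0
    exact ⟨hi'.integral_prod_left, hf0⟩
  have hcc : ENNReal.ofReal ((-c) ^ (2 * k)) ≤ ENNReal.ofReal (B ^ (2 * k)) := by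
    refine le_trans ?_ hv
    have h3 := ofReal_integral_even_pow_le ((integrable_const c).sub hIint.1) k
    simp only [Pi.sub_apply] at h3
    rw [integral_sub (integrable_const _) hIint.1, hIint.2] at h3
    simpa [(even_two_mul k).neg_pow] using h3
  have hv' : ∫⁻ p, ENNReal.ofReal ((c - I p.1) ^ (2 * k)) ∂γ.prod G ≤
      ENNReal.ofReal (B ^ (2 * k)) := by
    rw [lintegral_prod _ (by fun_prop)]
    simpa using hv
  have hvc := lintegral_add_even_pow_le (μ := γ.prod G) (v := fun _ => -c) (by fun_prop) hB hB hv'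
    (by simpa using hcc)
  have h := lintegral_add_even_pow_le (μ := γ.prod G) (by fun_prop) hA (by positivity) hu hvc
  rw [hμ, lintegral_map (by fun_prop) hXm]
  calc _ = ∫⁻ p, ENNReal.ofReal ((I p.1 - f (X p) + (c - I p.1 + -c)) ^ (2 * k)) ∂γ.prod G := by
        refine lintegral_congr fun p => ?_
        rw [show I p.1 - f (X p) + (c - I p.1 + -c) = -f (X p) by ring, (even_two_mul k).neg_pow]
    _ ≤ ENNReal.ofReal ((A + (B + B)) ^ (2 * k)) := h
    _ ≤ _ := by
        refine ENNReal.ofReal_le_ofReal ?_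
        rw [pow_mul, ← two_mul]
        exact pow_le_pow_left₀ (sq_nonneg _) hAB k

end TildeCauchy

section Tails

lemma meas_le_abs_le_of_lintegral_even_pow_le {Ω : Type*} [MeasurableSpace Ω] {μ : Measure Ω}
    {f : Ω → ℝ} (hf : Measurable f) {k : ℕ} {M t : ℝ} (ht : 0 < t)
    (h : ∫⁻ x, ENNReal.ofReal (f x ^ (2 * k)) ∂μ ≤ ENNReal.ofReal (M ^ k)) :
    μ {x | t ≤ |f x|} ≤ ENNReal.ofReal ((M / t ^ 2) ^ k) := by
  have hpos : 0 < t ^ (2 * k) := by positivity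
  rw [div_pow, ← pow_mul, ENNReal.ofReal_div_of_pos hpos]
  refine le_trans (measure_mono fun x (hx : t ≤ |f x|) => ?_)
    ((meas_ge_le_lintegral_div (by fun_prop) (by simpa using hpos) (by simp)).trans
      (ENNReal.div_le_div_right h _))
  refine ENNReal.ofReal_le_ofReal ?_
  rw [← (even_two_mul k).pow_abs (f x)]
  gcongr

lemma meas_le_abs_le_pow {Ω : Type*} [MeasurableSpace Ω] {μ : Measure Ω} {f : Ω → ℝ}
    {m : ℕ} {t : ℝ} (hf : Measurable f)
    (hmom : ∫⁻ x, ENNReal.ofReal (f x ^ (2 * m)) ∂μ ≤ ENNReal.ofReal ((80 * (m : ℝ) ^ 2) ^ m))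
    (ht : 0 < t) :
    μ {x | t ≤ |f x|} ≤ ENNReal.ofReal (2 * (7 * (2 * m) / t) ^ (2 * m)) := by
  refine (meas_le_abs_le_of_lintegral_even_pow_le hf ht hmom).trans
    (ENNReal.ofReal_le_ofReal ?_)
  have h : 80 * (m : ℝ) ^ 2 / t ^ 2 ≤ (7 * (2 * m) / t) ^ 2 := by
    rw [div_pow]
    gcongr
    nlinarith [sq_nonneg (m : ℝ)]
  calc _ ≤ ((7 * (2 * m) / t) ^ 2) ^ m := by gcongr
    _ = (7 * (2 * m) / t) ^ (2 * m) := by rw [pow_mul]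
    _ ≤ _ := le_mul_of_one_le_left (by positivity) (by norm_num)

lemma one_le_two_mul_exp_neg {x : ℝ} (hx : x ≤ log 2) : 1 ≤ 2 * exp (-x) := by
  have : exp (-log 2) ≤ exp (-x) := exp_le_exp.2 (by linarith)
  rw [exp_neg, exp_log two_pos] at this
  linarith

lemma div_exp_one_mul_pow_le {s : ℝ} {k : ℕ} (hk : 1 ≤ k) (hs : 1 / 2 ≤ s) (hks : s < 1 ∨ k ≤ s)
    (hk1 : s < 1 → k = 1) (hsk : s ≤ k + 1) :
    (k / (exp 1 * s)) ^ k ≤ 2 * exp (-s) := by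
  have hk' : (1 : ℝ) ≤ k := by exact_mod_cast hk
  have hs0 : 0 < s := by linarith
  rcases hks with hs1 | hks
  · obtain rfl := hk1 hs1
    have h := exp_pos 1
    have : exp s ≤ exp 1 := exp_le_exp.2 hs1.le
    rw [pow_one, exp_neg, ← div_eq_mul_inv, div_le_div_iff₀ (by positivity) (by positivity)]
    push_cast
    nlinarith
  · have h1 : k / (exp 1 * s) ≤ exp (k / s - 2) := by
      have := add_one_le_exp (k / s - 1)
      rw [mul_comm, ← div_div, div_le_iff₀ (exp_pos 1), ← exp_add]
      ring_nf at this ⊢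
      linarith
    calc _ ≤ exp (k / s - 2) ^ k := by gcongr
      _ = exp (k * (k / s - 2)) := by rw [← exp_nat_mul]
      _ ≤ exp (log 2 + -s) := by
        refine exp_le_exp.2 ?_
        have h2 : (k : ℝ) * (k / s - 2) = (s - k) ^ 2 / s - s := by field_simp; ring
        have h3 : (s - k) ^ 2 / s ≤ 1 / 2 := by
          rw [div_le_iff₀ hs0]
          nlinarith
        linarith [log_two_gt_d9]
      _ = _ := by rw [exp_add, exp_log two_pos]

variable {Ω : Type*} [MeasurableSpace Ω] {μ : Measure Ω} [IsProbabilityMeasure μ] {f : Ω → ℝ}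
  {m : ℕ} {t : ℝ}

lemma meas_le_abs_le_exp_neg_sq (hf : Measurable f)
    (hmom : ∀ k : ℕ, 1 ≤ k → 2 * k ≤ m →
      ∫⁻ x, ENNReal.ofReal (f x ^ (2 * k)) ∂μ ≤ ENNReal.ofReal ((32 * (k : ℝ)) ^ k))
    (ht : 0 ≤ t) (htm : t < 4 * √(exp 1 * m)) :
    μ {x | t ≤ |f x|} ≤ ENNReal.ofReal (2 * exp (-(t ^ 2 / (32 * exp 1)))) := by
  have he := exp_pos 1
  set s := t ^ 2 / (32 * exp 1) with hs
  have hts : t ^ 2 = 32 * (exp 1 * s) := by rw [hs]; field_simp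
  rcases le_or_gt s (log 2) with h | h
  · exact prob_le_one.trans (ENNReal.one_le_ofReal.2 (one_le_two_mul_exp_neg h))
  have hlog := log_two_gt_d9
  have htpos : 0 < t := lt_of_le_of_ne ht fun h0 => by
    rw [← h0] at hts
    have : 0 < exp 1 * s := mul_pos he (by linarith)
    linarith
  have hsm : 2 * s < m := by
    have h1 : t ^ 2 < (4 * √(exp 1 * m)) ^ 2 := by gcongr
    rw [mul_pow, sq_sqrt (by positivity), hts] at h1
    nlinarith
  obtain ⟨k, hk, hkm, hks, hk1, hsk⟩ : ∃ k : ℕ, 1 ≤ k ∧ 2 * k ≤ m ∧ (s < 1 ∨ k ≤ s) ∧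
      (s < 1 → k = 1) ∧ s ≤ k + 1 := by
    rcases lt_or_ge s 1 with hs1 | hs1
    · refine ⟨1, le_rfl, ?_, Or.inl hs1, fun _ => rfl, by push_cast; linarith⟩
      have : (1 : ℝ) < m := by linarith
      have : 1 < m := by exact_mod_cast this
      omega
    · have h1 := Nat.floor_le (zero_le_one.trans hs1)
      refine ⟨⌊s⌋₊, Nat.le_floor (by simpa using hs1), ?_, Or.inr h1, fun h => by linarith,
        (Nat.lt_floor_add_one s).le⟩
      have : (2 * ⌊s⌋₊ : ℝ) ≤ m := by linarith
      exact_mod_cast this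
  refine (meas_le_abs_le_of_lintegral_even_pow_le hf htpos (hmom k hk hkm)).trans
    (ENNReal.ofReal_le_ofReal ?_)
  rw [hts, mul_div_mul_left _ _ (by norm_num)]
  exact div_exp_one_mul_pow_le hk (by linarith) hks hk1 hsk

lemma meas_le_abs_le_exp_neg (hm : 1 ≤ m) (hf : Measurable f)
    (hmom : ∀ k : ℕ, 1 ≤ k → 2 * k ≤ m →
      ∫⁻ x, ENNReal.ofReal (f x ^ (2 * k)) ∂μ ≤ ENNReal.ofReal ((32 * (k : ℝ)) ^ k))
    (hmom' : ∫⁻ x, ENNReal.ofReal (f x ^ (2 * m)) ∂μ ≤ ENNReal.ofReal ((80 * (m : ℝ) ^ 2) ^ m))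
    (ht : 4 * √(exp 1 * m) ≤ t) (htm : t ≤ 7 * exp 1 * m) :
    μ {x | t ≤ |f x|} ≤ ENNReal.ofReal (2 * exp (-(t / (7 * exp 1)))) := by
  have he := exp_pos 1
  have he1 := exp_one_gt_d9
  have he2 := exp_one_lt_d9
  have hm' : (1 : ℝ) ≤ m := by exact_mod_cast hm
  have htpos : 0 < t := lt_of_lt_of_le (by positivity) ht
  set v := t / (7 * exp 1) with hv
  have htv : t = 7 * exp 1 * v := by rw [hv]; field_simp
  have hvm : v ≤ m := by rw [hv, div_le_iff₀ (by positivity)]; linarith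
  have ht2 : 16 * exp 1 * m ≤ t ^ 2 := by
    have h1 : (4 * √(exp 1 * m)) ^ 2 ≤ t ^ 2 := by gcongr
    rw [mul_pow, sq_sqrt (by positivity)] at h1
    linarith
  rcases le_or_gt v (log 2) with h | h
  · exact prob_le_one.trans (ENNReal.one_le_ofReal.2 (one_le_two_mul_exp_neg h))
  have hlog := log_two_gt_d9
  rcases eq_or_lt_of_le hm with rfl | hm2
  · refine (meas_le_abs_le_of_lintegral_even_pow_le hf htpos hmom').trans
      (ENNReal.ofReal_le_ofReal ?_)
    have h1 : 170 ≤ t ^ 2 := by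
      have : 13.1 ≤ t := by rw [htv]; nlinarith
      nlinarith
    have h2 : exp (-1) ≤ exp (-v) := exp_le_exp.2 (by simpa using hvm)
    have h3 : 1 / 3 ≤ exp (-1) := by
      rw [exp_neg, one_div]; exact inv_anti₀ he (by linarith)
    simp only [Nat.cast_one, one_pow, mul_one, pow_one]
    rw [div_le_iff₀ (by positivity)]
    nlinarith
  obtain ⟨k, hk, hkm, hmk⟩ : ∃ k : ℕ, 1 ≤ k ∧ 2 * k ≤ m ∧ m ≤ 2 * k + 1 :=
    ⟨m / 2, by omega, by omega, by omega⟩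
  have hk' : (1 : ℝ) ≤ k := by exact_mod_cast hk
  have hkm' : 2 * (k : ℝ) ≤ m := by exact_mod_cast hkm
  have hmk' : (m : ℝ) ≤ 2 * k + 1 := by exact_mod_cast hmk
  refine (meas_le_abs_le_of_lintegral_even_pow_le hf htpos (hmom k hk hkm)).trans
    (ENNReal.ofReal_le_ofReal ?_)
  rcases le_or_gt v k with hvk | hvk
  · have h1 : 32 * k / t ^ 2 ≤ exp (-1) := by
      rw [div_le_iff₀ (by positivity), exp_neg, inv_mul_eq_div, le_div_iff₀ he]
      nlinarith
    calc _ ≤ exp (-1) ^ k := by gcongr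
      _ = exp (-k) := by rw [← exp_nat_mul]; ring_nf
      _ ≤ exp (-v) := exp_le_exp.2 (by linarith)
      _ ≤ _ := by linarith [exp_pos (-v)]
  · have h1 : 32 * k / t ^ 2 ≤ 32 / 49 * exp (-2) := by
      have h2 : exp 2 = exp 1 ^ 2 := by rw [← exp_nat_mul]; norm_num
      have h3 : (k : ℝ) ≤ v ^ 2 := by nlinarith
      rw [div_le_iff₀ (by positivity), exp_neg, h2, htv]
      field_simp
      linarith
    calc _ ≤ (32 / 49 * exp (-2)) ^ k := by gcongr
      _ = (32 / 49 : ℝ) ^ k * exp (-(2 * k)) := by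
        rw [mul_pow, ← exp_nat_mul]; ring_nf
      _ ≤ 2 * exp (-1) * exp (-(2 * k)) := by
        gcongr
        have h4 : 1 / 3 ≤ exp (-1) := by
          rw [exp_neg, one_div]; exact inv_anti₀ he (by linarith)
        have h5 : (32 / 49 : ℝ) ^ k ≤ 32 / 49 :=
          pow_le_of_le_one (by norm_num) (by norm_num) (by omega)
        linarith
      _ = 2 * exp (-(2 * k + 1)) := by rw [mul_assoc, ← exp_add]; ring_nf
      _ ≤ _ := by gcongr; linarith

end Tails

end Auxiliary

/-- **Corollary 4.4 (concentration for rescaled Cauchy measures)**: let `β ≥ n + 1`,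
`p = 2⌊β − 3n/4⌋`, `t₀ = 4√(e⌊β − 3n/4⌋)`, `t₁ = 7e⌊β − 3n/4⌋`.  For every `f` with
`‖f‖_Lip ≤ 1` and `∫ f dν̃_β = 0`:
`ν̃_β(|f| ≥ t) ≤ 2e^{−t²/(32e)}` for `0 ≤ t < t₀`;
`ν̃_β(|f| ≥ t) ≤ 2e^{−t/(7e)}` for `t₀ ≤ t ≤ t₁`;
`ν̃_β(|f| ≥ t) ≤ 2(7p/t)^p` for `t ≥ t₁`. -/
theorem concentration_tilde_cauchy
    {n : ℕ} (hn : 0 < n) (β : ℝ) (hβ : (n : ℝ) + 1 ≤ β)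
    (f : EuclideanSpace ℝ (Fin n) → ℝ) (hf : LipschitzWith 1 f)
    (hf0 : (∫ x, f x ∂tildeCauchyMeasure n β) = 0) :
    (∀ t : ℝ, 0 ≤ t → t < 4 * Real.sqrt (Real.exp 1 * (⌊β - 3 * (n : ℝ) / 4⌋ : ℝ)) →
      tildeCauchyMeasure n β {x | t ≤ |f x|} ≤
        ENNReal.ofReal (2 * Real.exp (-(t ^ 2 / (32 * Real.exp 1))))) ∧
    (∀ t : ℝ, 4 * Real.sqrt (Real.exp 1 * (⌊β - 3 * (n : ℝ) / 4⌋ : ℝ)) ≤ t →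
      t ≤ 7 * Real.exp 1 * (⌊β - 3 * (n : ℝ) / 4⌋ : ℝ) →
      tildeCauchyMeasure n β {x | t ≤ |f x|} ≤
        ENNReal.ofReal (2 * Real.exp (-(t / (7 * Real.exp 1))))) ∧
    (∀ t : ℝ, 7 * Real.exp 1 * (⌊β - 3 * (n : ℝ) / 4⌋ : ℝ) ≤ t →
      tildeCauchyMeasure n β {x | t ≤ |f x|} ≤
        ENNReal.ofReal
          (2 * (7 * (2 * (⌊β - 3 * (n : ℝ) / 4⌋ : ℝ)) / t) ^
            (2 * (⌊β - 3 * (n : ℝ) / 4⌋ : ℝ)))) := by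
  have hn' : (1 : ℝ) ≤ n := by exact_mod_cast hn
  have hβn : (n : ℝ) < 2 * β := by linarith
  have hprob := isProbabilityMeasure_tildeCauchyMeasure hβn
  have hfloor : 1 ≤ ⌊β - 3 * (n : ℝ) / 4⌋ := Int.le_floor.2 (by push_cast; linarith)
  obtain ⟨m, hm⟩ := Int.eq_ofNat_of_zero_le (zero_le_one.trans hfloor)
  have hle := Int.floor_le (β - 3 * (n : ℝ) / 4)
  have hlt := Int.lt_floor_add_one (β - 3 * (n : ℝ) / 4)
  rw [hm] at hfloor hle hlt
  rw [hm]
  rw [Int.cast_natCast] at hle hlt ⊢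
  have hm1 : 1 ≤ m := by exact_mod_cast hfloor
  have hm1' : (1 : ℝ) ≤ m := by exact_mod_cast hm1
  have hnm : n ≤ 4 * m := by
    have : (n : ℝ) < (4 * m : ℕ) := by push_cast; linarith
    exact_mod_cast this.le
  have hfm : Measurable f := hf.continuous.measurable
  have hmom (k : ℕ) (hk : 1 ≤ k) (hkm : 2 * k ≤ m) := by
    have hkm' : 2 * (k : ℝ) ≤ m := by exact_mod_cast hkm
    exact lintegral_even_pow_tildeCauchyMeasure_le (n := n) (β := β) (k := k) (by linarith) hk
      (by linarith) hf hf0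
  have hmom' := lintegral_even_pow_tildeCauchyMeasure_le_pow hβn hm1 (by linarith) hnm hf hf0
  refine ⟨fun t ht htm => meas_le_abs_le_exp_neg_sq hfm hmom ht htm,
    fun t ht htm => meas_le_abs_le_exp_neg hm1 hfm hmom hmom' ht htm, fun t ht => ?_⟩
  have htpos : 0 < t := lt_of_lt_of_le (by positivity) ht
  convert meas_le_abs_le_pow hfm hmom' htpos using 3
  exact_mod_cast rpow_natCast (7 * (2 * (m : ℝ)) / t) (2 * m)
end
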